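/- arXiv:2305.00707 — 5 statements merged into one kernel-verified Lean document; each statement's English description precedes it below -/
import Mathlib

section
/- Let 𝔛 be an ℓ-variate P-polynomial association scheme on a domain D with respect to a monomial order ≤. Then for every α ∈ ℕ^ℓ, the matrix 𝐀^α := A_{ε₁}^{n₁}⋯A_{ε_ℓ}^{n_ℓ} (where α = (n₁,…,n_ℓ)) lies in the ℂ-linear span of the set {𝐀^β : β ∈ D, β ≤ α}. -/
open scoped BigOperators
open Matrix

noncomputable section

/-- The all-ones matrix `J`. -/
def matJ (X : Type*) : Matrix X X ℂ := Matrix.of fun _ _ => 1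

/-- A family of matrices `A : ι → Matrix X X ℂ` forms a commutative association scheme:
0-1 matrices summing to `J`, containing the identity, closed under transpose, whose
pairwise products are linear combinations of the family and commute. -/
structure IsAssocScheme {X ι : Type*} [Fintype X] [DecidableEq X] [Fintype ι]
    (A : ι → Matrix X X ℂ) : Prop where
  entries_zero_one : ∀ (i : ι) (x y : X), A i x y = 0 ∨ A i x y = 1
  sum_eq_J : ∑ i, A i = matJ X
  exists_id : ∃ i₀, A i₀ = 1
  exists_transpose : ∀ i, ∃ i', (A i)ᵀ = A i'
  mul_eq_lin : ∀ i j, ∃ p : ι → ℂ, A i * A j = ∑ k, p k • A k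
  mul_comm' : ∀ i j, A i * A j = A j * A i

/-- A monomial order on `ℕ^ℓ`: a total well-ordering compatible with addition. -/
structure MonOrder (ℓ : ℕ) where
  le : (Fin ℓ → ℕ) → (Fin ℓ → ℕ) → Prop
  le_refl : ∀ a, le a a
  le_trans : ∀ a b c, le a b → le b c → le a c
  le_antisymm : ∀ a b, le a b → le b a → a = b
  le_total : ∀ a b, le a b ∨ le b a
  wf : WellFounded fun a b => le a b ∧ a ≠ b
  add_compat : ∀ a b c, le a b → le (a + c) (b + c)

/-- The `i`-th standard unit vector of `ℕ^ℓ`. -/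
def epsV {ℓ : ℕ} (i : Fin ℓ) : Fin ℓ → ℕ := Pi.single i 1

/-- Conversion from `Fin ℓ → ℕ` to exponents of `MvPolynomial`. -/
def toExp {ℓ : ℕ} (α : Fin ℓ → ℕ) : Fin ℓ →₀ ℕ := Finsupp.equivFunOnFinite.symm α

/-- `α` is the multidegree of `f` with respect to the monomial order `mo`. -/
def IsMultideg {ℓ : ℕ} (mo : MonOrder ℓ) (f : MvPolynomial (Fin ℓ) ℂ) (α : Fin ℓ → ℕ) : Prop :=
  MvPolynomial.coeff (toExp α) f ≠ 0 ∧ ∀ d ∈ f.support, mo.le (⇑d) α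

/-- The ordered monomial `M 1 ^ α 1 * ⋯ * M ℓ ^ α ℓ`. -/
def mpow {X : Type*} [Fintype X] [DecidableEq X] {ℓ : ℕ}
    (M : Fin ℓ → Matrix X X ℂ) (α : Fin ℓ → ℕ) : Matrix X X ℂ :=
  ((List.finRange ℓ).map fun i => M i ^ α i).prod

/-- Evaluation of a multivariate polynomial at a family of matrices. -/
def matEval {X : Type*} [Fintype X] [DecidableEq X] {ℓ : ℕ}
    (f : MvPolynomial (Fin ℓ) ℂ) (M : Fin ℓ → Matrix X X ℂ) : Matrix X X ℂ :=
  ∑ d ∈ f.support, MvPolynomial.coeff d f • mpow M (⇑d)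

/-- `ℓ`-variate `P`-polynomial association scheme on the domain `D` with respect to the
monomial order `mo`, with adjacency matrices (relabeled) `A α` for `α ∈ D`. -/
structure IsMultiPPoly {X : Type*} [Fintype X] [DecidableEq X] {ℓ : ℕ}
    (D : Finset (Fin ℓ → ℕ)) (mo : MonOrder ℓ)
    (A : (Fin ℓ → ℕ) → Matrix X X ℂ) : Prop where
  scheme : IsAssocScheme fun α : {a // a ∈ D} => A α.1
  eps_mem : ∀ i : Fin ℓ, epsV i ∈ D
  lower_closed : ∀ α ∈ D, ∀ β : Fin ℓ → ℕ, (∀ i, β i ≤ α i) → β ∈ D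
  exists_poly : ∀ α ∈ D, ∃ v : MvPolynomial (Fin ℓ) ℂ,
    A α = matEval v (fun i => A (epsV i)) ∧ IsMultideg mo v α ∧
      ∀ d ∈ v.support, ⇑d ∈ D
  recur : ∀ i : Fin ℓ, ∀ α ∈ D, ∃ c : (Fin ℓ → ℕ) → ℂ,
    (A (epsV i) * mpow (fun j => A (epsV j)) α
        = ∑ β ∈ D, c β • mpow (fun j => A (epsV j)) β) ∧
      ∀ β ∈ D, c β ≠ 0 → mo.le β (α + epsV i)

/-- The Hadamard (entrywise) monomial `E 1 ^{∘ α 1} ∘ ⋯ ∘ E ℓ ^{∘ α ℓ}`. -/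
def hpow {X : Type*} {ℓ : ℕ} (E : Fin ℓ → Matrix X X ℂ) (α : Fin ℓ → ℕ) : Matrix X X ℂ :=
  Matrix.of fun x y => ∏ i, (E i x y) ^ α i

/-- Evaluation of a multivariate polynomial at a family of matrices under the
Hadamard product. -/
def hEval {X : Type*} {ℓ : ℕ}
    (f : MvPolynomial (Fin ℓ) ℂ) (E : Fin ℓ → Matrix X X ℂ) : Matrix X X ℂ :=
  ∑ d ∈ f.support, MvPolynomial.coeff d f • hpow E (⇑d)

/-- `E` is the family of primitive idempotents of the Bose–Mesner algebra spanned by `A`. -/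
structure IsPrimIdem {X ι κ : Type*} [Fintype X] [DecidableEq X] [Fintype ι] [Fintype κ]
    (A : ι → Matrix X X ℂ) (E : κ → Matrix X X ℂ) : Prop where
  idem : ∀ j, E j * E j = E j
  orth : ∀ j k, j ≠ k → E j * E k = 0
  sum_eq_one : ∑ j, E j = 1
  span_eq : Submodule.span ℂ (Set.range E) = Submodule.span ℂ (Set.range A)

/-- `ℓ`-variate `Q`-polynomial association scheme on the domain `D` with respect to the
monomial order `mo`; `A` are the adjacency matrices and `E α` for `α ∈ D` the (relabeled)
primitive idempotents. -/
structure IsMultiQPoly {X ι : Type*} [Fintype X] [DecidableEq X] [Fintype ι] {ℓ : ℕ}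
    (D : Finset (Fin ℓ → ℕ)) (mo : MonOrder ℓ)
    (A : ι → Matrix X X ℂ) (E : (Fin ℓ → ℕ) → Matrix X X ℂ) : Prop where
  scheme : IsAssocScheme A
  primIdem : IsPrimIdem A fun α : {a // a ∈ D} => E α.1
  eps_mem : ∀ i : Fin ℓ, epsV i ∈ D
  lower_closed : ∀ α ∈ D, ∀ β : Fin ℓ → ℕ, (∀ i, β i ≤ α i) → β ∈ D
  exists_poly : ∀ α ∈ D, ∃ v : MvPolynomial (Fin ℓ) ℂ,
    (Fintype.card X : ℂ) • E α
        = hEval v (fun i => (Fintype.card X : ℂ) • E (epsV i)) ∧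
      IsMultideg mo v α ∧ ∀ d ∈ v.support, ⇑d ∈ D
  recur : ∀ i : Fin ℓ, ∀ α ∈ D, ∃ c : (Fin ℓ → ℕ) → ℂ,
    (Matrix.hadamard (E (epsV i)) (hpow (fun j => E (epsV j)) α)
        = ∑ β ∈ D, c β • hpow (fun j => E (epsV j)) β) ∧
      ∀ β ∈ D, c β ≠ 0 → mo.le β (α + epsV i)

/-- The graded lexicographic order on `ℕ^ℓ`. -/
def grlexLe {ℓ : ℕ} (a b : Fin ℓ → ℕ) : Prop :=
  (∑ i, a i) < (∑ i, b i) ∨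
    ((∑ i, a i) = (∑ i, b i) ∧
      (a = b ∨ ∃ i, (∀ j, j < i → a j = b j) ∧ a i < b i))

/-- The lexicographic order on `ℕ^ℓ`. -/
def lexLe {ℓ : ℕ} (a b : Fin ℓ → ℕ) : Prop :=
  a = b ∨ ∃ i, (∀ j, j < i → a j = b j) ∧ a i < b i

/-- Evaluation of a univariate polynomial at a matrix under the Hadamard product. -/
def hEval1 {X : Type*} (v : Polynomial ℂ) (M : Matrix X X ℂ) : Matrix X X ℂ :=
  ∑ n ∈ v.support, v.coeff n • Matrix.of fun x y => (M x y) ^ n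

end

/-- Multiplying by a factor `M i` raises the `i`-th exponent of an ordered product of powers of
commuting elements by one. -/
theorem List.prod_map_pow_add_single {R ι : Type*} [Monoid R] [DecidableEq ι] (M : ι → R)
    (hM : ∀ i j, Commute (M i) (M j)) (a : ι → ℕ) (i : ι) (l : List ι) (hl : l.Nodup)
    (hi : i ∈ l) :
    (l.map fun j => M j ^ (a + Pi.single i 1 : ι → ℕ) j).prod = M i * (l.map fun j => M j ^ a j).prod := by
  induction l with
  | nil => simp at hi
  | cons b t ih =>
    rw [List.nodup_cons] at hl
    by_cases hb : i = b
    · subst hb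
      have ht : (t.map fun j => M j ^ (a + Pi.single i 1 : ι → ℕ) j) = t.map fun j => M j ^ a j := by
        refine List.map_congr_left fun j hj => ?_
        have hji : j ≠ i := fun h => hl.1 (h ▸ hj)
        simp [hji]
      rw [List.map_cons, List.map_cons, List.prod_cons, List.prod_cons, ht]
      simp [pow_succ', mul_assoc]
    · have hit : i ∈ t := (List.mem_cons.1 hi).resolve_left hb
      rw [List.map_cons, List.map_cons, List.prod_cons, List.prod_cons, ih hl.2 hit,
        ← mul_assoc, ← mul_assoc, ((hM i b).pow_right (a b)).eq]
      simp [Ne.symm hb]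

theorem mpow_add_epsV {X : Type*} [Fintype X] [DecidableEq X] {ℓ : ℕ}
    (M : Fin ℓ → Matrix X X ℂ) (hM : ∀ i j, Commute (M i) (M j)) (α : Fin ℓ → ℕ) (i : Fin ℓ) :
    mpow M (α + epsV i) = M i * mpow M α :=
  List.prod_map_pow_add_single M hM α i _ (List.nodup_finRange ℓ) (List.mem_finRange i)

theorem IsMultiPPoly.zero_mem {X : Type*} [Fintype X] [DecidableEq X] {ℓ : ℕ}
    {D : Finset (Fin ℓ → ℕ)} {mo : MonOrder ℓ} {A : (Fin ℓ → ℕ) → Matrix X X ℂ}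
    (hP : IsMultiPPoly D mo A) : 0 ∈ D := by
  obtain ⟨i₀, -⟩ := hP.scheme.exists_id
  exact hP.lower_closed i₀.1 i₀.2 0 fun i => Nat.zero_le _

/-- An exponent vector can be built up from `0` by adding unit vectors. -/
theorem epsV_induction {ℓ : ℕ} {p : (Fin ℓ → ℕ) → Prop} (zero : p 0)
    (add : ∀ α i, p α → p (α + epsV i)) (α : Fin ℓ → ℕ) : p α := by
  induction h : ∑ i, α i generalizing α with
  | zero =>
    have hα : α = 0 := funext fun i => Finset.sum_eq_zero_iff.1 h i (Finset.mem_univ i)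
    exact hα ▸ zero
  | succ n ih =>
    obtain ⟨i, -, hi⟩ := Finset.exists_ne_zero_of_sum_ne_zero (h.trans_ne n.succ_ne_zero)
    have hα : α - epsV i + epsV i = α := by
      funext j
      by_cases hj : j = i
      · subst hj
        simp only [Pi.add_apply, Pi.sub_apply, epsV, Pi.single_eq_same]
        omega
      · simp [epsV, hj]
    rw [← hα]
    refine add _ i (ih _ ?_)
    rw [← hα] at h
    simp only [Pi.add_apply, Finset.sum_add_distrib] at h
    have h1 : ∑ j, epsV i j = 1 := by simp [epsV]
    omega

/-- Lemma 2.9: for an `ℓ`-variate `P`-polynomial association scheme on `D`, every monomial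
`𝐀^α` lies in the span of the monomials `𝐀^β` with `β ∈ D` and `β ≤ α`. -/
theorem monomial_mem_span {X : Type*} [Fintype X] [DecidableEq X] {ℓ : ℕ}
    (D : Finset (Fin ℓ → ℕ)) (mo : MonOrder ℓ) (A : (Fin ℓ → ℕ) → Matrix X X ℂ)
    (hP : IsMultiPPoly D mo A) (α : Fin ℓ → ℕ) :
    mpow (fun i => A (epsV i)) α ∈
      Submodule.span ℂ
        ((fun β => mpow (fun i => A (epsV i)) β) '' {β : Fin ℓ → ℕ | β ∈ D ∧ mo.le β α}) := by
  induction α using epsV_induction with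
  | zero => exact Submodule.subset_span ⟨0, ⟨hP.zero_mem, mo.le_refl 0⟩, rfl⟩
  | add α i ih =>
    rw [mpow_add_epsV _ (fun i j => hP.scheme.mul_comm' ⟨_, hP.eps_mem i⟩ ⟨_, hP.eps_mem j⟩)]
    generalize mpow (fun i => A (epsV i)) α = B at ih
    induction ih using Submodule.span_induction with
    | mem x hx =>
      obtain ⟨β, ⟨hβ, hle⟩, rfl⟩ := hx
      obtain ⟨c, hc, hcle⟩ := hP.recur i β hβ
      rw [hc]
      refine Submodule.sum_mem _ fun γ hγ => ?_
      by_cases h0 : c γ = 0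
      · simp [h0]
      · exact Submodule.smul_mem _ _ (Submodule.subset_span
          ⟨γ, ⟨hγ, mo.le_trans _ _ _ (hcle γ hγ h0) (mo.add_compat _ _ _ hle)⟩, rfl⟩)
    | zero => simp
    | add x y _ _ hx hy => rw [mul_add]; exact Submodule.add_mem _ hx hy
    | smul c x _ hx => rw [mul_smul_comm]; exact Submodule.smul_mem _ c hx
end

section
/- Let 𝔛 = (X, {R_i}_{i=0}^5) be the distance scheme of the dodecahedral graph (the 1-skeleton of the regular dodecahedron, a distance-regular graph on 20 vertices of diameter 5), with primitive idempotents E_0,…,E_5 indexed so that the eigenvalue of the adjacency matrix A_1 on the column space of E_j is 3, √5, 1, 0, −2, −√5 for j = 0,1,2,3,4,5 respectively. Relabel E_{00} := E_0, E_{01} := E_1, E_{02} := E_2, E_{10} := E_3, E_{11} := E_4, E_{03} := E_5, and let D* := {(0,0),(0,1),(0,2),(0,3),(1,0),(1,1)}. Then 𝔛 is a bivariate Q-polynomial association scheme on D* with respect to the graded lexicographic order ≤_grlex. -/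
open scoped BigOperators
open Matrix

/-- The domain of the dodecahedral labelling, in the order of the idempotents `E_0,…,E_5`. -/
def dodecaLabel : Fin 6 → Fin 2 → ℕ :=
  ![![0, 0], ![0, 1], ![0, 2], ![1, 0], ![1, 1], ![0, 3]]

lemma dodecaLabel_injective : Function.Injective dodecaLabel := by
  unfold Function.Injective dodecaLabel
  decide

lemma image_dodecaLabel :
    ({![0, 0], ![0, 1], ![0, 2], ![0, 3], ![1, 0], ![1, 1]} : Finset (Fin 2 → ℕ))
      = Finset.univ.image dodecaLabel := by
  unfold dodecaLabel
  decide

/-- The dual eigenvalues of the dodecahedral scheme, `s` being a square root of `5`. -/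
noncomputable def dodecaDual (s : ℂ) : Fin 6 → Fin 6 → ℂ :=
  ![![1, 1, 1, 1, 1, 1], ![3, s, 1, -1, -s, -3], ![5, 5 / 3, -5 / 3, -5 / 3, 5 / 3, 5],
    ![4, 0, -2, 2, 0, -4], ![4, -8 / 3, 2 / 3, 2 / 3, -8 / 3, 4], ![3, -s, 1, -1, s, -3]]

lemma grlexLe_fin_two {a b : Fin 2 → ℕ} (h : a 0 + a 1 < b 0 + b 1 ∨
    (a 0 + a 1 = b 0 + b 1 ∧ a 0 ≤ b 0)) : grlexLe a b := by
  unfold grlexLe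
  rw [Fin.sum_univ_two, Fin.sum_univ_two]
  rcases h with h | ⟨h, h'⟩
  · exact Or.inl h
  · refine Or.inr ⟨h, ?_⟩
    rcases h'.lt_or_eq with h'' | h''
    · exact Or.inr ⟨0, fun j hj => absurd hj (Fin.not_lt_zero j), h''⟩
    · left
      ext i
      fin_cases i
      · exact h''
      · change a 1 = b 1
        omega

lemma hEval_apply {X : Type*} {ℓ : ℕ} (f : MvPolynomial (Fin ℓ) ℂ)
    (M : Fin ℓ → Matrix X X ℂ) (x y : X) :
    hEval f M x y = MvPolynomial.eval (fun i => M i x y) f := by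
  simp [hEval, hpow, MvPolynomial.eval_eq', Matrix.sum_apply]

/-- A linear combination of Hadamard monomials is the value of a polynomial with the
corresponding multidegree. -/
lemma exists_hEval_eq {X : Type*} {ℓ : ℕ} (mo : MonOrder ℓ) (D : Finset (Fin ℓ → ℕ))
    (M : Fin ℓ → Matrix X X ℂ) (α : Fin ℓ → ℕ) (hα : α ∈ D) (c : (Fin ℓ → ℕ) → ℂ)
    (hc : c α ≠ 0) (hle : ∀ β ∈ D, c β ≠ 0 → mo.le β α) :
    ∃ v : MvPolynomial (Fin ℓ) ℂ, ∑ β ∈ D, c β • hpow M β = hEval v M ∧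
      IsMultideg mo v α ∧ ∀ d ∈ v.support, ⇑d ∈ D := by
  classical
  have hcoeff : ∀ d : Fin ℓ →₀ ℕ,
      MvPolynomial.coeff d (∑ β ∈ D, MvPolynomial.monomial (toExp β) (c β))
        = if ⇑d ∈ D then c d else 0 := by
    intro d
    have key : ∀ β, toExp β = d ↔ ⇑d = β := fun β =>
      ⟨fun h => by rw [← h]; rfl, fun h => by rw [← h]; exact Finsupp.ext fun _ => rfl⟩
    simp only [MvPolynomial.coeff_sum, MvPolynomial.coeff_monomial, key]
    exact Finset.sum_ite_eq D _ _
  have hsupp : ∀ d ∈ (∑ β ∈ D, MvPolynomial.monomial (toExp β) (c β)).support,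
      ⇑d ∈ D ∧ c d ≠ 0 := by
    intro d hd
    rw [MvPolynomial.mem_support_iff, hcoeff] at hd
    by_cases h : ⇑d ∈ D
    · exact ⟨h, by simpa [h] using hd⟩
    · simp [h] at hd
  refine ⟨∑ β ∈ D, MvPolynomial.monomial (toExp β) (c β), ?_, ⟨?_, ?_⟩,
    fun d hd => (hsupp d hd).1⟩
  · ext x y
    rw [hEval_apply]
    simp only [map_sum, MvPolynomial.eval_monomial, Matrix.sum_apply, Matrix.smul_apply,
      smul_eq_mul, hpow, Matrix.of_apply]
    refine Finset.sum_congr rfl fun β _ => ?_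
    rw [Finsupp.prod_fintype _ _ fun i => pow_zero _]
    rfl
  · rw [hcoeff]
    simpa [toExp, hα] using hc
  · exact fun d hd => hle _ (hsupp d hd).1 (hsupp d hd).2

/-- In an association scheme every entry position lies in exactly one relation. -/
lemma IsAssocScheme.exists_relation {X ι : Type*} [Fintype X] [DecidableEq X] [Fintype ι]
    [DecidableEq ι] {A : ι → Matrix X X ℂ} (h : IsAssocScheme A) (x y : X) :
    ∃ i, ∀ j, A j x y = if j = i then 1 else 0 := by
  have hs : ∑ i, A i x y = 1 := by
    have := congrFun (congrFun h.sum_eq_J x) y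
    simpa [Matrix.sum_apply, matJ] using this
  have hcount : ((Finset.univ.filter fun i => A i x y = 1).card : ℂ) = 1 := by
    refine Eq.trans ?_ hs
    rw [Finset.card_filter, Nat.cast_sum]
    refine Finset.sum_congr rfl fun i _ => ?_
    rcases h.entries_zero_one i x y with h0 | h0 <;> simp [h0]
  obtain ⟨i, hi⟩ := Finset.card_eq_one.mp (by exact_mod_cast hcount)
  refine ⟨i, fun j => ?_⟩
  have hj : A j x y = 1 ↔ j = i := by simpa using Finset.ext_iff.mp hi j
  split_ifs with hji
  · exact hj.mpr hji
  · exact (h.entries_zero_one j x y).resolve_right fun h1 => hji (hj.mp h1)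

/-- The distance matrices of a graph with the intersection array of the dodecahedron act on an
eigenspace of `A 1` through the corresponding orthogonal polynomials. -/
lemma dodeca_mul_eigen {X : Type*} [Fintype X] [DecidableEq X] {A : ℕ → Matrix X X ℂ}
    (hA0 : A 0 = 1)
    (hrec1 : A 1 * A 1 = (3 : ℂ) • A 0 + A 2)
    (hrec2 : A 1 * A 2 = (2 : ℂ) • A 1 + A 2 + A 3)
    (hrec3 : A 1 * A 3 = A 2 + A 3 + (2 : ℂ) • A 4)
    (hrec4 : A 1 * A 4 = A 3 + (3 : ℂ) • A 5)
    {F : Matrix X X ℂ} {t v₂ v₃ v₄ v₅ : ℂ} (h : A 1 * F = t • F)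
    (h₂ : v₂ = t ^ 2 - 3) (h₃ : v₃ = t * v₂ - 2 * t - v₂)
    (h₄ : 2 * v₄ = t * v₃ - v₂ - v₃) (h₅ : 3 * v₅ = t * v₄ - v₃) :
    A 2 * F = v₂ • F ∧ A 3 * F = v₃ • F ∧ A 4 * F = v₄ • F ∧ A 5 * F = v₅ • F := by
  have step : ∀ {B : Matrix X X ℂ} {v : ℂ}, B * F = v • F → A 1 * B * F = (t * v) • F := by
    intro B v hB
    rw [Matrix.mul_assoc, hB, Matrix.mul_smul, h, smul_smul, _root_.mul_comm]
  have e₂ : A 2 * F = v₂ • F := by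
    have := step h
    rw [hrec1, hA0, Matrix.add_mul, Matrix.smul_mul, Matrix.one_mul] at this
    rw [h₂]
    linear_combination (norm := module) this
  have e₃ : A 3 * F = v₃ • F := by
    have := step e₂
    rw [hrec2, Matrix.add_mul, Matrix.add_mul, Matrix.smul_mul, h, e₂] at this
    rw [h₃]
    linear_combination (norm := module) this
  have e₄ : A 4 * F = v₄ • F := by
    have := step e₃
    rw [hrec3, Matrix.add_mul, Matrix.add_mul, Matrix.smul_mul, e₂, e₃] at this
    have h2 : v₄ = (t * v₃ - v₂ - v₃) / 2 := by linear_combination h₄ / 2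
    rw [h2]
    linear_combination (norm := module) (1 / 2 : ℂ) • this
  have e₅ : A 5 * F = v₅ • F := by
    have := step e₄
    rw [hrec4, Matrix.add_mul, Matrix.smul_mul, e₃] at this
    have h2 : v₅ = (t * v₄ - v₃) / 3 := by linear_combination h₅ / 3
    rw [h2]
    linear_combination (norm := module) (1 / 3 : ℂ) • this
  exact ⟨e₂, e₃, e₄, e₅⟩

/-- The idempotents of the dodecahedral scheme have the dual eigenvalues as entries. -/
lemma dodeca_entries {X : Type*} [Fintype X] [DecidableEq X]
    {A E : ℕ → Matrix X X ℂ} {s : ℂ}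
    (hscheme : IsAssocScheme fun i : Fin 6 => A i)
    (hA0 : A 0 = 1)
    (hrec1 : A 1 * A 1 = (3 : ℂ) • A 0 + A 2)
    (hrec2 : A 1 * A 2 = (2 : ℂ) • A 1 + A 2 + A 3)
    (hrec3 : A 1 * A 3 = A 2 + A 3 + (2 : ℂ) • A 4)
    (hrec4 : A 1 * A 4 = A 3 + (3 : ℂ) • A 5)
    (hprim : IsPrimIdem (fun i : Fin 6 => A i) (fun j : Fin 6 => E j))
    (hs : s ^ 2 = 5)
    (heig : ∀ j : Fin 6, A 1 * E j = (![3, s, 1, 0, -2, -s] j) • E j) (x y : X) :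
    ∃ r : Fin 6, ∀ j : Fin 6, E j x y = dodecaDual s j r / 20 := by
  have hsum : ∀ B : Matrix X X ℂ,
      B = B * E 0 + B * E 1 + B * E 2 + B * E 3 + B * E 4 + B * E 5 := by
    intro B
    have h : E 0 + E 1 + E 2 + E 3 + E 4 + E 5 = 1 := by
      simpa [Fin.sum_univ_succ, add_assoc] using hprim.sum_eq_one
    rw [← Matrix.mul_add, ← Matrix.mul_add, ← Matrix.mul_add, ← Matrix.mul_add,
      ← Matrix.mul_add, h, Matrix.mul_one]
  have e0 : A 1 * E 0 = (3 : ℂ) • E 0 := heig 0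
  have e1 : A 1 * E 1 = s • E 1 := heig 1
  have e2 : A 1 * E 2 = (1 : ℂ) • E 2 := heig 2
  have e3 : A 1 * E 3 = (0 : ℂ) • E 3 := heig 3
  have e4 : A 1 * E 4 = (-2 : ℂ) • E 4 := heig 4
  have e5 : A 1 * E 5 = (-s) • E 5 := heig 5
  obtain ⟨a0, b0, c0, d0⟩ := dodeca_mul_eigen (v₂ := 6) (v₃ := 6) (v₄ := 3) (v₅ := 1)
    hA0 hrec1 hrec2 hrec3 hrec4 e0 (by norm_num) (by norm_num) (by norm_num) (by norm_num)
  obtain ⟨a1, b1, c1, d1⟩ := dodeca_mul_eigen (v₂ := 2) (v₃ := -2) (v₄ := -s) (v₅ := -1)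
    hA0 hrec1 hrec2 hrec3 hrec4 e1 (by linear_combination -hs) (by ring) (by ring)
    (by linear_combination hs)
  obtain ⟨a2, b2, c2, d2⟩ := dodeca_mul_eigen (v₂ := -2) (v₃ := -2) (v₄ := 1) (v₅ := 1)
    hA0 hrec1 hrec2 hrec3 hrec4 e2 (by norm_num) (by norm_num) (by norm_num) (by norm_num)
  obtain ⟨a3, b3, c3, d3⟩ := dodeca_mul_eigen (v₂ := -3) (v₃ := 3) (v₄ := 0) (v₅ := -1)
    hA0 hrec1 hrec2 hrec3 hrec4 e3 (by norm_num) (by norm_num) (by norm_num) (by norm_num)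
  obtain ⟨a4, b4, c4, d4⟩ := dodeca_mul_eigen (v₂ := 1) (v₃ := 1) (v₄ := -2) (v₅ := 1)
    hA0 hrec1 hrec2 hrec3 hrec4 e4 (by norm_num) (by norm_num) (by norm_num) (by norm_num)
  obtain ⟨a5, b5, c5, d5⟩ := dodeca_mul_eigen (v₂ := 2) (v₃ := -2) (v₄ := s) (v₅ := -1)
    hA0 hrec1 hrec2 hrec3 hrec4 e5 (by linear_combination -hs) (by ring) (by ring)
    (by linear_combination hs)
  have entry : ∀ {M N : Matrix X X ℂ}, M = N → M x y = N x y := fun h => by rw [h]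
  have f0 := hsum 1
  have f1 := hsum (A 1)
  have f2 := hsum (A 2)
  have f3 := hsum (A 3)
  have f4 := hsum (A 4)
  have f5 := hsum (A 5)
  simp only [Matrix.one_mul] at f0
  rw [← hA0] at f0
  rw [e0, e1, e2, e3, e4, e5] at f1
  rw [a0, a1, a2, a3, a4, a5] at f2
  rw [b0, b1, b2, b3, b4, b5] at f3
  rw [c0, c1, c2, c3, c4, c5] at f4
  rw [d0, d1, d2, d3, d4, d5] at f5
  replace f0 := entry f0
  replace f1 := entry f1
  replace f2 := entry f2
  replace f3 := entry f3
  replace f4 := entry f4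
  replace f5 := entry f5
  simp only [Matrix.add_apply, Matrix.smul_apply, smul_eq_mul] at f0 f1 f2 f3 f4 f5
  obtain ⟨r, hr⟩ := hscheme.exists_relation x y
  have g : ∀ j : Fin 6, E j x y = (dodecaDual s j 0 * A 0 x y + dodecaDual s j 1 * A 1 x y
      + dodecaDual s j 2 * A 2 x y + dodecaDual s j 3 * A 3 x y + dodecaDual s j 4 * A 4 x y
      + dodecaDual s j 5 * A 5 x y) / 20 := by
    intro j
    rw [f0, f1, f2, f3, f4, f5]
    fin_cases j <;> simp [dodecaDual]
    · ring
    · linear_combination (-1 / 10 * E 1 x y + 1 / 10 * E 5 x y) * hs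
    · ring
    · ring
    · ring
    · linear_combination (1 / 10 * E 1 x y - 1 / 10 * E 5 x y) * hs
  refine ⟨r, fun j => ?_⟩
  have g0 := hr 0
  have g1 := hr 1
  have g2 := hr 2
  have g3 := hr 3
  have g4 := hr 4
  have g5 := hr 5
  simp only [Fin.coe_ofNat_eq_mod, Nat.zero_mod, Nat.reduceMod] at g0 g1 g2 g3 g4 g5
  rw [g j, g0, g1, g2, g3, g4, g5]
  fin_cases r <;> simp

/-- The dual eigenvalues as bivariate polynomials in those of `E_3` and `E_1`. -/
lemma dodeca_polynomial {s : ℂ} (hs : s ^ 2 = 5) (n : Fin 6) : ∃ c : Fin 6 → ℂ, c n ≠ 0 ∧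
    (∀ m, c m ≠ 0 → grlexLe (dodecaLabel m) (dodecaLabel n)) ∧
    ∀ r, dodecaDual s n r = ∑ m, c m *
      (dodecaDual s 3 r ^ dodecaLabel m 0 * dodecaDual s 1 r ^ dodecaLabel m 1) := by
  have hs3 : s ^ 3 = 5 * s := by linear_combination s * hs
  refine ⟨(![![1, 0, 0, 0, 0, 0], ![0, 1, 0, 0, 0, 0], ![-5 / 2, 0, 5 / 6, 0, 0, 0],
    ![0, 0, 0, 1, 0, 0], ![4, 0, -4 / 3, 0, 1, 0], ![0, -27 / 2, 0, -6, 0, 5 / 2]] :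
    Fin 6 → Fin 6 → ℂ) n, ?_, ?_, ?_⟩
  · fin_cases n <;> simp
  · intro m hm
    apply grlexLe_fin_two
    fin_cases n <;> fin_cases m <;> simp [dodecaLabel] at hm ⊢
  · intro r
    fin_cases n <;> fin_cases r <;>
      simp [Fin.sum_univ_six, dodecaDual, dodecaLabel, hs] <;> ring_nf <;>
      simp [hs3] <;> ring

set_option maxHeartbeats 1000000 in
/-- The recurrence relations for the Hadamard monomials in `E_3` and `E_1`. -/
lemma dodeca_recurrence {s : ℂ} (hs : s ^ 2 = 5) (i : Fin 2) (n : Fin 6) : ∃ c : Fin 6 → ℂ,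
    (∀ m, c m ≠ 0 → grlexLe (dodecaLabel m) (dodecaLabel n + epsV i)) ∧
    ∀ r, ![dodecaDual s 3 r / 20, dodecaDual s 1 r / 20] i *
        ((dodecaDual s 3 r / 20) ^ dodecaLabel n 0 * (dodecaDual s 1 r / 20) ^ dodecaLabel n 1)
      = ∑ m, c m * ((dodecaDual s 3 r / 20) ^ dodecaLabel m 0 *
        (dodecaDual s 1 r / 20) ^ dodecaLabel m 1) := by
  have hs3 : s ^ 3 = 5 * s := by linear_combination s * hs
  have hs4 : s ^ 4 = 25 := by linear_combination (s ^ 2 + 5) * hs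
  refine ⟨(![![![0, 0, 0, 1, 0, 0], ![0, 0, 0, 0, 1, 0], ![0, -1 / 10, 0, -3 / 80, 0, 8],
      ![1 / 40, 0, -2, 0, 2, 0], ![0, -7 / 40, 0, -3 / 40, 0, 14],
      ![3 / 20000, 0, -3 / 250, 0, 53 / 2000, 0]],
    ![![0, 1, 0, 0, 0, 0], ![0, 0, 1, 0, 0, 0], ![0, 0, 0, 0, 0, 1], ![0, 0, 0, 0, 1, 0],
      ![0, -1 / 10, 0, -3 / 80, 0, 8], ![3 / 160000, 0, 11 / 1000, 0, 1 / 125, 0]]] :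
    Fin 2 → Fin 6 → Fin 6 → ℂ) i n, ?_, ?_⟩
  · intro m hm
    apply grlexLe_fin_two
    fin_cases i <;> fin_cases n <;> fin_cases m <;> simp [dodecaLabel, epsV] at hm ⊢
  · intro r
    fin_cases i <;> fin_cases n <;> fin_cases r <;>
      simp [Fin.sum_univ_six, dodecaDual, dodecaLabel, div_pow] <;> ring_nf <;>
      simp [hs, hs3, hs4] <;> ring

/-- Theorem 3.2: the distance scheme of the dodecahedral graph (the distance-regular graph on
20 vertices of diameter 5 with intersection array {3,2,1,1,1; 1,1,1,2,3}), with its primitive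
idempotents `E_0,…,E_5` labeled so that the eigenvalue of `A_1` on the column space of `E_j`
is `3, √5, 1, 0, −2, −√5` respectively, and relabeled as `E_{00} := E_0`, `E_{01} := E_1`,
`E_{02} := E_2`, `E_{10} := E_3`, `E_{11} := E_4`, `E_{03} := E_5`, is a bivariate
`Q`-polynomial association scheme on `D* = {(0,0),(0,1),(0,2),(0,3),(1,0),(1,1)}` with
respect to the graded lexicographic order. -/
theorem dodecahedron_isMultiQPoly {X : Type*} [Fintype X] [DecidableEq X]
    (hcard : Fintype.card X = 20)
    (A : ℕ → Matrix X X ℂ) (E : ℕ → Matrix X X ℂ)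
    (hscheme : IsAssocScheme fun i : Fin 6 => A i)
    (hsym : ∀ i : Fin 6, (A (i : ℕ))ᵀ = A (i : ℕ))
    (hA0 : A 0 = 1)
    (hrec1 : A 1 * A 1 = (3 : ℂ) • A 0 + A 2)
    (hrec2 : A 1 * A 2 = (2 : ℂ) • A 1 + A 2 + A 3)
    (hrec3 : A 1 * A 3 = A 2 + A 3 + (2 : ℂ) • A 4)
    (hrec4 : A 1 * A 4 = A 3 + (3 : ℂ) • A 5)
    (hrec5 : A 1 * A 5 = A 4)
    (hprim : IsPrimIdem (fun i : Fin 6 => A i) (fun j : Fin 6 => E j))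
    (heig : ∀ j : Fin 6,
      A 1 * E j
        = (![(3 : ℂ), ((Real.sqrt 5 : ℝ) : ℂ), 1, 0, -2, -((Real.sqrt 5 : ℝ) : ℂ)] j) • E j)
    (E2 : (Fin 2 → ℕ) → Matrix X X ℂ)
    (hE00 : E2 ![0, 0] = E 0) (hE01 : E2 ![0, 1] = E 1) (hE02 : E2 ![0, 2] = E 2)
    (hE10 : E2 ![1, 0] = E 3) (hE11 : E2 ![1, 1] = E 4) (hE03 : E2 ![0, 3] = E 5)
    (mo : MonOrder 2) (hmo : mo.le = fun a b => grlexLe a b) :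
    IsMultiQPoly
      ({![0, 0], ![0, 1], ![0, 2], ![0, 3], ![1, 0], ![1, 1]} : Finset (Fin 2 → ℕ))
      mo (fun i : Fin 6 => A i) E2 := by
  obtain ⟨s, hs⟩ : ∃ s : ℂ, ((Real.sqrt 5 : ℝ) : ℂ) = s := ⟨_, rfl⟩
  have hs2 : s ^ 2 = 5 := by
    rw [← hs]
    exact_mod_cast Real.sq_sqrt (by norm_num : (0 : ℝ) ≤ 5)
  rw [hs] at heig
  have hentry : ∀ x y, ∃ r : Fin 6, ∀ j : Fin 6, E j x y = dodecaDual s j r / 20 :=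
    dodeca_entries hscheme hA0 hrec1 hrec2 hrec3 hrec4 hprim hs2 heig
  have hlabel : ∀ n : Fin 6, E2 (dodecaLabel n) = E n := by
    intro n
    fin_cases n
    exacts [hE00, hE01, hE02, hE10, hE11, hE03]
  rw [image_dodecaLabel]
  have hmem : ∀ a : {a // a ∈ Finset.univ.image dodecaLabel}, ∃ n, dodecaLabel n = a.1 :=
    fun a => let ⟨n, _, hn⟩ := Finset.mem_image.mp a.2; ⟨n, hn⟩
  have heps : (fun i => E2 (epsV i)) = ![E 3, E 1] := by
    have h0 : (epsV 0 : Fin 2 → ℕ) = ![1, 0] := by decide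
    have h1 : (epsV 1 : Fin 2 → ℕ) = ![0, 1] := by decide
    funext i
    fin_cases i
    · exact (congrArg E2 h0).trans hE10
    · exact (congrArg E2 h1).trans hE01
  have hpoly : ∀ n : Fin 6, ∃ c : Fin 6 → ℂ, c n ≠ 0 ∧
      (∀ m, c m ≠ 0 → grlexLe (dodecaLabel m) (dodecaLabel n)) ∧
      ∀ r, dodecaDual s n r = ∑ m, c m *
        (dodecaDual s 3 r ^ dodecaLabel m 0 * dodecaDual s 1 r ^ dodecaLabel m 1) :=
    dodeca_polynomial hs2
  have hrecur : ∀ (i : Fin 2) (n : Fin 6), ∃ c : Fin 6 → ℂ,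
      (∀ m, c m ≠ 0 → grlexLe (dodecaLabel m) (dodecaLabel n + epsV i)) ∧
      ∀ r, ![dodecaDual s 3 r / 20, dodecaDual s 1 r / 20] i *
          ((dodecaDual s 3 r / 20) ^ dodecaLabel n 0 * (dodecaDual s 1 r / 20) ^ dodecaLabel n 1)
        = ∑ m, c m * ((dodecaDual s 3 r / 20) ^ dodecaLabel m 0 *
          (dodecaDual s 1 r / 20) ^ dodecaLabel m 1) :=
    dodeca_recurrence hs2
  have hextend : ∀ (c : Fin 6 → ℂ) (n : Fin 6),
      Function.extend dodecaLabel c 0 (dodecaLabel n) = c n :=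
    fun c n => dodecaLabel_injective.extend_apply c 0 n
  refine ⟨hscheme, ⟨?_, ?_, ?_, ?_⟩, ?_, ?_, ?_, ?_⟩
  · intro a
    obtain ⟨n, hn⟩ := hmem a
    simp only [← hn, hlabel]
    exact hprim.idem n
  · intro a b hab
    obtain ⟨n, hn⟩ := hmem a
    obtain ⟨m, hm⟩ := hmem b
    simp only [← hn, ← hm, hlabel]
    refine hprim.orth n m ?_
    rintro rfl
    exact hab (Subtype.ext (hn.symm.trans hm))
  · rw [Finset.sum_coe_sort (Finset.univ.image dodecaLabel) E2,
      Finset.sum_image dodecaLabel_injective.injOn]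
    simp only [hlabel]
    exact hprim.sum_eq_one
  · rw [← hprim.span_eq]
    congr 1
    ext M
    constructor
    · rintro ⟨a, rfl⟩
      obtain ⟨n, hn⟩ := hmem a
      exact ⟨n, by simp only [← hn, hlabel]⟩
    · rintro ⟨n, rfl⟩
      exact ⟨⟨dodecaLabel n, Finset.mem_image_of_mem _ (Finset.mem_univ n)⟩, hlabel n⟩
  · rw [← image_dodecaLabel]
    decide
  · rw [← image_dodecaLabel]
    intro α hα β hβ
    have h0 := hβ 0
    have h1 := hβ 1
    have hβ' : β = ![β 0, β 1] := by
      ext i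
      fin_cases i <;> rfl
    rw [hβ']
    generalize β 0 = p at *
    generalize β 1 = q at *
    simp only [Finset.mem_insert, Finset.mem_singleton] at hα
    rcases hα with rfl | rfl | rfl | rfl | rfl | rfl <;>
      simp only [Matrix.cons_val_zero, Matrix.cons_val_one] at h0 h1 <;>
      interval_cases p <;> interval_cases q <;> decide
  · intro α hα
    obtain ⟨n, hn⟩ := hmem ⟨α, hα⟩
    obtain rfl : dodecaLabel n = α := hn
    obtain ⟨c, hc, hle, hval⟩ := hpoly n
    obtain ⟨v, hv, hdeg⟩ := exists_hEval_eq mo (Finset.univ.image dodecaLabel)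
      (fun i => (Fintype.card X : ℂ) • E2 (epsV i)) (dodecaLabel n) hα
      (Function.extend dodecaLabel c 0) (by rwa [hextend])
      (by
        intro β hβ hcβ
        obtain ⟨m, rfl⟩ := hmem ⟨β, hβ⟩
        rw [hextend] at hcβ
        rw [hmo]
        exact hle m hcβ)
    refine ⟨v, ?_, hdeg⟩
    rw [← hv, Finset.sum_image dodecaLabel_injective.injOn]
    simp only [hextend, hlabel, congrFun heps, hcard]
    ext x y
    obtain ⟨r, hr⟩ := hentry x y
    have h1 : E 1 x y = dodecaDual s 1 r / 20 := hr 1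
    have h3 : E 3 x y = dodecaDual s 3 r / 20 := hr 3
    have hv := hval r
    simp only [Matrix.sum_apply, Matrix.smul_apply, smul_eq_mul, hpow, Matrix.of_apply,
      Fin.prod_univ_two, Matrix.cons_val_zero, Matrix.cons_val_one, hr, h1, h3, Nat.cast_ofNat,
      mul_div_cancel₀ _ (by norm_num : (20 : ℂ) ≠ 0)]
    exact hv
  · intro i α hα
    obtain ⟨n, hn⟩ := hmem ⟨α, hα⟩
    obtain rfl : dodecaLabel n = α := hn
    obtain ⟨c, hle, hval⟩ := hrecur i n
    refine ⟨Function.extend dodecaLabel c 0, ?_, ?_⟩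
    · rw [Finset.sum_image dodecaLabel_injective.injOn]
      simp only [hextend, congrFun heps]
      ext x y
      obtain ⟨r, hr⟩ := hentry x y
      have h1 : E 1 x y = dodecaDual s 1 r / 20 := hr 1
      have h3 : E 3 x y = dodecaDual s 3 r / 20 := hr 3
      have hi : (![E 3, E 1] : Fin 2 → Matrix X X ℂ) i x y
          = ![dodecaDual s 3 r / 20, dodecaDual s 1 r / 20] i := by
        fin_cases i
        exacts [h3, h1]
      have hv := hval r
      simp only [Matrix.sum_apply, Matrix.smul_apply, smul_eq_mul, hpow, Matrix.of_apply,
        Fin.prod_univ_two, Matrix.cons_val_zero, Matrix.cons_val_one, h1, h3,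
        Matrix.hadamard_apply, hi]
      exact hv
    · intro β hβ hcβ
      obtain ⟨m, rfl⟩ := hmem ⟨β, hβ⟩
      rw [hextend] at hcβ
      rw [hmo]
      exact hle m hcβ
end

section
/- Let 𝔛^(k) = (X^(k), {A^(k)_i}_{i=0}^{d_k}) for k = 1,…,ℓ be P-polynomial association schemes. Then the direct product ⊗_{k=1}^ℓ 𝔛^(k), with adjacency matrices A_{(n₁,…,n_ℓ)} := A^(1)_{n₁} ⊗ ⋯ ⊗ A^(ℓ)_{n_ℓ} indexed by D := {0,…,d₁}×⋯×{0,…,d_ℓ}, is an ℓ-variate P-polynomial association scheme on D with respect to every monomial order ≤ on ℕ^ℓ. -/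
open scoped BigOperators
open Matrix

/-- The Kronecker product of a finite family of square matrices, as a monoid homomorphism. -/
def piKronecker {ι R : Type*} [Fintype ι] [DecidableEq ι] [CommSemiring R] (X : ι → Type*)
    [∀ k, Fintype (X k)] [∀ k, DecidableEq (X k)] :
    (∀ k, Matrix (X k) (X k) R) →* Matrix (∀ k, X k) (∀ k, X k) R where
  toFun M := Matrix.of fun x y => ∏ k, M k (x k) (y k)
  map_one' := by
    ext x y
    rw [Matrix.of_apply]
    by_cases h : x = y
    · subst h
      simp
    · obtain ⟨k, hk⟩ := Function.ne_iff.mp h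
      rw [Matrix.one_apply_ne h]
      exact Finset.prod_eq_zero (Finset.mem_univ k) (Matrix.one_apply_ne hk)
  map_mul' M N := by
    ext x y
    simp only [Matrix.of_apply, Pi.mul_apply, Matrix.mul_apply, ← Finset.prod_mul_distrib,
      Finset.prod_univ_sum, Fintype.piFinset_univ]

section piKronecker

variable {ι R : Type*} [Fintype ι] [DecidableEq ι] [CommSemiring R] {X : ι → Type*}
  [∀ k, Fintype (X k)] [∀ k, DecidableEq (X k)]

lemma piKronecker_apply (M : ∀ k, Matrix (X k) (X k) R) (x y : ∀ k, X k) :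
    piKronecker X M x y = ∏ k, M k (x k) (y k) := rfl

lemma piKronecker_sum_smul {κ : ι → Type*} (s : ∀ k, Finset (κ k)) (c : ∀ k, κ k → R)
    (M : ∀ k, κ k → Matrix (X k) (X k) R) :
    piKronecker X (fun k => ∑ n ∈ s k, c k n • M k n) =
      ∑ β ∈ Fintype.piFinset s, (∏ k, c k (β k)) • piKronecker X (fun k => M k (β k)) := by
  ext x y
  simp only [piKronecker_apply, Matrix.sum_apply, Matrix.smul_apply, smul_eq_mul,
    Finset.prod_univ_sum, Finset.prod_mul_distrib]

end piKronecker

lemma mpow_piKronecker_mulSingle {ℓ : ℕ} {X : Fin ℓ → Type*} [∀ k, Fintype (X k)]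
    [∀ k, DecidableEq (X k)] (M : ∀ k, Matrix (X k) (X k) ℂ) (α : Fin ℓ → ℕ) :
    mpow (fun i => piKronecker X (Pi.mulSingle i (M i))) α =
      piKronecker X (fun k => M k ^ α k) := by
  have hprod : ((List.finRange ℓ).map fun i => Pi.mulSingle i (M i) ^ α i).prod =
      fun k => M k ^ α k := by
    funext k
    rw [← Pi.evalMonoidHom_apply _ k (List.prod _), map_list_prod, List.map_map,
      List.prod_map_eq_pow_single k, List.count_eq_one_of_mem (List.nodup_finRange ℓ)
        (List.mem_finRange k)]
    · simp
    · intro i hi _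
      simp [Pi.mulSingle_eq_of_ne hi.symm]
  rw [← hprod, map_list_prod, List.map_map, mpow]
  simp [Function.comp_def]

namespace MonOrder

variable {ℓ : ℕ} (mo : MonOrder ℓ)

lemma zero_le (γ : Fin ℓ → ℕ) : mo.le 0 γ := by
  rcases mo.le_total 0 γ with h | h
  · exact h
  obtain ⟨_, ⟨n, rfl⟩, hn⟩ := mo.wf.has_min (Set.range fun n : ℕ => n • γ) ⟨_, 0, rfl⟩
  have hle : mo.le ((n + 1) • γ) (n • γ) := by
    simpa only [succ_nsmul', zero_add] using mo.add_compat γ 0 (n • γ) h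
  have heq : (n + 1) • γ = n • γ := by
    by_contra hne
    exact hn _ ⟨n + 1, rfl⟩ ⟨hle, hne⟩
  have hγ : γ = 0 := by simpa only [succ_nsmul', add_eq_right] using heq
  exact hγ ▸ mo.le_refl 0

lemma le_of_pointwise {α β : Fin ℓ → ℕ} (h : ∀ i, β i ≤ α i) : mo.le β α := by
  have := mo.add_compat 0 (α - β) β (mo.zero_le _)
  rwa [zero_add, tsub_add_cancel_of_le (show β ≤ α from h)] at this

end MonOrder

lemma toExp_coe {ℓ : ℕ} (e : Fin ℓ →₀ ℕ) : toExp ⇑e = e :=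
  Finsupp.equivFunOnFinite.symm_apply_apply e

lemma coe_toExp {ℓ : ℕ} (α : Fin ℓ → ℕ) : ⇑(toExp α) = α := rfl

lemma toExp_injective {ℓ : ℕ} : Function.Injective (toExp (ℓ := ℓ)) :=
  Finsupp.equivFunOnFinite.symm.injective

lemma coeff_sum_monomial_toExp {ℓ : ℕ} (D : Finset (Fin ℓ → ℕ)) (c : (Fin ℓ → ℕ) → ℂ)
    (e : Fin ℓ →₀ ℕ) :
    MvPolynomial.coeff e (∑ β ∈ D, MvPolynomial.monomial (toExp β) (c β)) =
      if ⇑e ∈ D then c e else 0 := by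
  have h (β : Fin ℓ → ℕ) : toExp β = e ↔ ⇑e = β :=
    ⟨fun h => h ▸ coe_toExp β, fun h => h ▸ toExp_coe e⟩
  simp [MvPolynomial.coeff_sum, MvPolynomial.coeff_monomial, h]

lemma matEval_sum_monomial_toExp {X : Type*} [Fintype X] [DecidableEq X] {ℓ : ℕ}
    (D : Finset (Fin ℓ → ℕ)) (c : (Fin ℓ → ℕ) → ℂ) (M : Fin ℓ → Matrix X X ℂ) :
    matEval (∑ β ∈ D, MvPolynomial.monomial (toExp β) (c β)) M = ∑ β ∈ D, c β • mpow M β := by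
  classical
  rw [matEval, Finset.sum_subset (s₂ := D.image toExp), Finset.sum_image toExp_injective.injOn]
  · refine Finset.sum_congr rfl fun β hβ => ?_
    rw [coeff_sum_monomial_toExp, coe_toExp, if_pos hβ]
  · intro e he
    rw [MvPolynomial.mem_support_iff, coeff_sum_monomial_toExp] at he
    exact Finset.mem_image.mpr ⟨e, by_contra fun h => he (if_neg h), toExp_coe e⟩
  · intro e _ he
    rw [MvPolynomial.notMem_support_iff.mp he, zero_smul]

lemma aeval_eq_sum_range_of_degree_eq {S : Type*} [Ring S] [Algebra ℂ S] {v : Polynomial ℂ}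
    {i d : ℕ} (hv : v.degree = i) (hi : i ≤ d) (a : S) :
    Polynomial.aeval a v = ∑ n ∈ Finset.range (d + 1), v.coeff n • a ^ n :=
  Polynomial.aeval_eq_sum_range' (by rw [Polynomial.natDegree_eq_of_degree_eq_some hv]; omega) a

section PPolynomial

variable {X : Type*} [Fintype X] [DecidableEq X] {d : ℕ} {A : ℕ → Matrix X X ℂ}

lemma IsAssocScheme.mul_eq_sum_range (hA : IsAssocScheme fun i : Fin (d + 1) => A i) {i j : ℕ}
    (hi : i ≤ d) (hj : j ≤ d) :
    ∃ p : ℕ → ℂ, A i * A j = ∑ n ∈ Finset.range (d + 1), p n • A n := by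
  obtain ⟨p, hp⟩ := hA.mul_eq_lin ⟨i, by omega⟩ ⟨j, by omega⟩
  refine ⟨fun n => if h : n < d + 1 then p ⟨n, h⟩ else 0, ?_⟩
  rw [Finset.sum_range]
  simpa only [Fin.is_lt, dite_true, Fin.eta] using hp

lemma IsAssocScheme.pow_mem_span (hA : IsAssocScheme fun i : Fin (d + 1) => A i) (hd : 1 ≤ d)
    (hA0 : A 0 = 1) (n : ℕ) : A 1 ^ n ∈ Submodule.span ℂ (A '' Set.Iic d) := by
  induction n with
  | zero => exact Submodule.subset_span ⟨0, Nat.zero_le d, by rw [hA0, pow_zero]⟩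
  | succ n ih =>
    rw [pow_succ']
    suffices h : Submodule.span ℂ (A '' Set.Iic d) ≤
        (Submodule.span ℂ (A '' Set.Iic d)).comap (LinearMap.mulLeft ℂ (A 1)) from h ih
    rw [Submodule.span_le]
    rintro _ ⟨j, hj, rfl⟩
    obtain ⟨p, hp⟩ := hA.mul_eq_sum_range hd hj
    change A 1 * A j ∈ Submodule.span ℂ (A '' Set.Iic d)
    rw [hp]
    exact Submodule.sum_mem _ fun m hm => Submodule.smul_mem _ _ <|
      Submodule.subset_span ⟨m, Nat.lt_succ_iff.mp (Finset.mem_range.mp hm), rfl⟩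

lemma IsAssocScheme.pow_eq_sum_range (hA : IsAssocScheme fun i : Fin (d + 1) => A i)
    (hd : 1 ≤ d) (hA0 : A 0 = 1)
    (hP : ∀ i ≤ d, ∃ v : Polynomial ℂ, v.degree = (i : ℕ) ∧ A i = Polynomial.aeval (A 1) v)
    (n : ℕ) :
    ∃ c : ℕ → ℂ, A 1 ^ n = ∑ j ∈ Finset.range (d + 1), c j • A 1 ^ j ∧
      ∀ j ≤ d, c j ≠ 0 → j ≤ n := by
  by_cases hn : n ≤ d
  · refine ⟨Pi.single n 1, ?_, fun j _ hj => ?_⟩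
    · simp [Pi.single_apply, ite_smul, hn]
    · by_contra h
      exact hj (Pi.single_eq_of_ne (by omega) 1)
  · suffices h : Submodule.span ℂ (A '' Set.Iic d) ≤
        Submodule.span ℂ ((fun j => A 1 ^ j) '' (Finset.range (d + 1) : Set ℕ)) by
      obtain ⟨c, hc⟩ := (Submodule.mem_span_image_finset_iff_exists_fun' ℂ).mp
        (h (hA.pow_mem_span hd hA0 n))
      exact ⟨c, hc.symm, fun j hj _ => by omega⟩
    rw [Submodule.span_le]
    rintro _ ⟨i, hi, rfl⟩
    obtain ⟨v, hv, hAv⟩ := hP i hi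
    rw [hAv, aeval_eq_sum_range_of_degree_eq hv hi]
    exact Submodule.sum_mem _ fun m hm => Submodule.smul_mem _ _ <|
      Submodule.subset_span ⟨m, hm, rfl⟩

end PPolynomial

section DirectProduct

variable {ℓ : ℕ} {X : Fin ℓ → Type*} [∀ k, Fintype (X k)] [∀ k, DecidableEq (X k)]
  {d : Fin ℓ → ℕ} {A : ∀ k, ℕ → Matrix (X k) (X k) ℂ}

lemma isAssocScheme_piKronecker (hscheme : ∀ k, IsAssocScheme fun i : Fin (d k + 1) => A k i)
    (hsym : ∀ k, ∀ i ≤ d k, (A k i)ᵀ = A k i) (hA0 : ∀ k, A k 0 = 1) :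
    IsAssocScheme fun α : {a // a ∈ Fintype.piFinset fun k => Finset.range (d k + 1)} =>
      piKronecker X fun k => A k (α.1 k) := by
  have hle (α : {a // a ∈ Fintype.piFinset fun k => Finset.range (d k + 1)}) (k : Fin ℓ) :
      α.1 k ≤ d k :=
    Nat.lt_succ_iff.mp (Finset.mem_range.mp (Fintype.mem_piFinset.mp α.2 k))
  refine ⟨fun α x y => ?_, ?_, ?_, fun α => ⟨α, ?_⟩, fun α β => ?_, fun α β => ?_⟩
  · by_cases h : ∃ k, A k (α.1 k) (x k) (y k) = 0
    · obtain ⟨k, hk⟩ := h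
      exact Or.inl (Finset.prod_eq_zero (Finset.mem_univ k) hk)
    · push Not at h
      exact Or.inr <| (piKronecker_apply _ x y).trans <| Finset.prod_eq_one fun k _ =>
        ((hscheme k).entries_zero_one ⟨α.1 k, Nat.lt_succ_of_le (hle α k)⟩ _ _).resolve_left (h k)
  · rw [Finset.sum_coe_sort (Fintype.piFinset fun k => Finset.range (d k + 1))
      fun α => piKronecker X fun k => A k (α k)]
    have h := piKronecker_sum_smul (fun k => Finset.range (d k + 1)) (fun _ _ => (1 : ℂ)) A
    simp only [one_smul, Finset.prod_const_one] at h
    rw [← h]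
    ext x y
    refine (piKronecker_apply _ x y).trans (Finset.prod_eq_one fun k _ => ?_)
    rw [Finset.sum_range, (hscheme k).sum_eq_J]
    rfl
  · refine ⟨⟨0, by simp⟩, ?_⟩
    simp only [Pi.zero_apply, hA0]
    exact map_one (piKronecker X)
  · ext x y
    rw [Matrix.transpose_apply, piKronecker_apply, piKronecker_apply]
    refine Finset.prod_congr rfl fun k _ => ?_
    exact congrFun₂ (hsym k _ (hle α k)) (x k) (y k)
  · choose p hp using fun k => (hscheme k).mul_eq_sum_range (hle α k) (hle β k)
    refine ⟨fun γ => ∏ k, p k (γ.1 k), ?_⟩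
    rw [← map_mul, Finset.sum_coe_sort (Fintype.piFinset fun k => Finset.range (d k + 1))
      fun γ => (∏ k, p k (γ k)) • piKronecker X fun k => A k (γ k), ← piKronecker_sum_smul]
    exact congrArg _ (funext hp)
  · simp only [← map_mul]
    refine congrArg _ (funext fun k => ?_)
    exact (hscheme k).mul_comm' ⟨α.1 k, Nat.lt_succ_of_le (hle α k)⟩
      ⟨β.1 k, Nat.lt_succ_of_le (hle β k)⟩

lemma piKronecker_epsV (hA0 : ∀ k, A k 0 = 1) (i : Fin ℓ) :
    piKronecker X (fun k => A k (epsV i k)) = piKronecker X (Pi.mulSingle i (A i 1)) := by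
  refine congrArg _ (funext fun k => ?_)
  by_cases h : k = i
  · subst h
    simp [epsV]
  · simp [epsV, h, hA0]

end DirectProduct

/-- Theorem 4.1 (i): the direct product of `P`-polynomial association schemes
`𝔛^{(1)}, …, 𝔛^{(ℓ)}` (with adjacency matrices given by Kronecker products
`A^{(1)}_{n 1} ⊗ ⋯ ⊗ A^{(ℓ)}_{n ℓ}`) is an `ℓ`-variate `P`-polynomial association scheme on
`D = {0,…,d 1} × ⋯ × {0,…,d ℓ}` with respect to every monomial order. -/
theorem directProduct_isMultiPPoly {ℓ : ℕ} (X : Fin ℓ → Type*)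
    [∀ k, Fintype (X k)] [∀ k, DecidableEq (X k)]
    (d : Fin ℓ → ℕ) (hd : ∀ k, 1 ≤ d k)
    (A : ∀ k, ℕ → Matrix (X k) (X k) ℂ)
    (hscheme : ∀ k, IsAssocScheme fun i : Fin (d k + 1) => A k i)
    (hsym : ∀ k, ∀ i ≤ d k, (A k i)ᵀ = A k i)
    (hA0 : ∀ k, A k 0 = 1)
    (hP : ∀ k, ∀ i ≤ d k, ∃ v : Polynomial ℂ,
      v.degree = (i : ℕ) ∧ A k i = Polynomial.aeval (A k 1) v)
    (mo : MonOrder ℓ) :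
    IsMultiPPoly (Fintype.piFinset fun k => Finset.range (d k + 1)) mo
      (fun α => Matrix.of fun x y : ∀ k, X k => ∏ k, A k (α k) (x k) (y k)) := by
  change IsMultiPPoly _ mo fun α => piKronecker X fun k => A k (α k)
  have hpow (α : Fin ℓ → ℕ) :
      mpow (fun i => piKronecker X fun k => A k (epsV i k)) α =
        piKronecker X fun k => A k 1 ^ α k := by
    simp only [piKronecker_epsV hA0]
    exact mpow_piKronecker_mulSingle (fun k => A k 1) α
  have hmem (α : Fin ℓ → ℕ) :
      (α ∈ Fintype.piFinset fun k => Finset.range (d k + 1)) ↔ ∀ k, α k ≤ d k := by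
    simp
  refine ⟨isAssocScheme_piKronecker hscheme hsym hA0, fun i => ?_, fun α hα β hβ => ?_,
    fun α hα => ?_, fun i α hα => ?_⟩
  · refine (hmem _).mpr fun k => le_trans ?_ (hd k)
    rw [epsV, Pi.single_apply]
    split_ifs <;> simp
  · exact (hmem β).mpr fun k => (hβ k).trans ((hmem α).mp hα k)
  · have hle := (hmem α).mp hα
    choose v hv hAv using fun k => hP k (α k) (hle k)
    refine ⟨∑ β ∈ Fintype.piFinset fun k => Finset.range (d k + 1),
      MvPolynomial.monomial (toExp β) (∏ k, (v k).coeff (β k)), ?_, ⟨?_, fun e he => ?_⟩,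
      fun e he => ?_⟩
    · simp only [matEval_sum_monomial_toExp, hpow]
      rw [← piKronecker_sum_smul _ (fun k n => (v k).coeff n) (fun k n => A k 1 ^ n)]
      exact congrArg _ (funext fun k =>
        (hAv k).trans (aeval_eq_sum_range_of_degree_eq (hv k) (hle k) _))
    · rw [coeff_sum_monomial_toExp, coe_toExp, if_pos hα]
      exact Finset.prod_ne_zero_iff.mpr fun k _ => Polynomial.coeff_ne_zero_of_eq_degree (hv k)
    · rw [MvPolynomial.mem_support_iff, coeff_sum_monomial_toExp] at he
      refine mo.le_of_pointwise fun k => ?_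
      have hk := Finset.prod_ne_zero_iff.mp (ite_ne_right_iff.mp he).2 k (Finset.mem_univ k)
      exact_mod_cast (hv k) ▸ Polynomial.le_degree_of_ne_zero hk
    · rw [MvPolynomial.mem_support_iff, coeff_sum_monomial_toExp] at he
      exact (ite_ne_right_iff.mp he).1
  · choose c hc hcle using fun k =>
      (hscheme k).pow_eq_sum_range (hd k) (hA0 k) (hP k) ((α + epsV i) k)
    refine ⟨fun β => ∏ k, c k (β k), ?_, fun β hβ h => mo.le_of_pointwise fun k =>
      hcle k _ ((hmem β).mp hβ k) (Finset.prod_ne_zero_iff.mp h k (Finset.mem_univ k))⟩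
    simp only [hpow]
    rw [← piKronecker_sum_smul _ c (fun k n => A k 1 ^ n), ← funext hc, piKronecker_epsV hA0,
      ← map_mul]
    refine congrArg _ (funext fun k => ?_)
    by_cases h : k = i
    · subst h
      simp [epsV, pow_succ']
    · simp [epsV, h]
end

section
/- Let 𝔛^(k) = (X^(k), {A^(k)_i}_{i=0}^{d_k}) for k = 1,…,ℓ be Q-polynomial association schemes. Then the direct product ⊗_{k=1}^ℓ 𝔛^(k), whose primitive idempotents are E_{(n₁,…,n_ℓ)} := E^(1)_{n₁} ⊗ ⋯ ⊗ E^(ℓ)_{n_ℓ} indexed by D := {0,…,d₁}×⋯×{0,…,d_ℓ}, is an ℓ-variate Q-polynomial association scheme on D with respect to every monomial order ≤ on ℕ^ℓ. -/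
open scoped BigOperators
open Matrix

/-- The Kronecker product `M 1 ⊗ ⋯ ⊗ M ℓ` of a family of square matrices. -/
def piKron {κ : Type*} [Fintype κ] {X : κ → Type*} (M : ∀ k, Matrix (X k) (X k) ℂ) :
    Matrix (∀ k, X k) (∀ k, X k) ℂ :=
  Matrix.of fun x y => ∏ k, M k (x k) (y k)

section PiKron

variable {κ : Type*} [Fintype κ] {X : κ → Type*}

lemma piKron_sum [DecidableEq κ] (s : κ → Finset ℕ) (M : ∀ k, ℕ → Matrix (X k) (X k) ℂ) :
    piKron (fun k => ∑ n ∈ s k, M k n) =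
      ∑ α ∈ Fintype.piFinset s, piKron fun k => M k (α k) := by
  ext x y
  simp [piKron, Matrix.sum_apply, Finset.prod_univ_sum]

lemma piKron_smul (c : κ → ℂ) (M : ∀ k, Matrix (X k) (X k) ℂ) :
    piKron (fun k => c k • M k) = (∏ k, c k) • piKron M := by
  ext x y
  simp [piKron, Finset.prod_mul_distrib]

lemma piKron_transpose (M : ∀ k, Matrix (X k) (X k) ℂ) :
    (piKron M)ᵀ = piKron fun k => (M k)ᵀ := rfl

lemma piKron_matJ : piKron (fun k => matJ (X k)) = matJ (∀ k, X k) := by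
  ext x y
  simp [piKron, matJ]

lemma piKron_eq_zero (M : ∀ k, Matrix (X k) (X k) ℂ) (k : κ) (hk : M k = 0) :
    piKron M = 0 := by
  ext x y
  exact Finset.prod_eq_zero (Finset.mem_univ k) (by simp [hk])

lemma piKron_one [∀ k, DecidableEq (X k)] :
    piKron (fun k => (1 : Matrix (X k) (X k) ℂ)) = 1 := by
  ext x y
  simp only [piKron, Matrix.of_apply, Matrix.one_apply]
  split_ifs with h
  · simp [h]
  · obtain ⟨k, hk⟩ := Function.ne_iff.mp h
    exact Finset.prod_eq_zero (Finset.mem_univ k) (by simp [hk])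

lemma piKron_mul [DecidableEq κ] [∀ k, Fintype (X k)] (M N : ∀ k, Matrix (X k) (X k) ℂ) :
    piKron M * piKron N = piKron fun k => M k * N k := by
  ext x y
  simp [piKron, Matrix.mul_apply, Finset.prod_univ_sum, Finset.prod_mul_distrib]

end PiKron

/-- The box `{0,…,d 1} × ⋯ × {0,…,d ℓ}`. -/
abbrev degreeBox {κ : Type*} [Fintype κ] [DecidableEq κ] (d : κ → ℕ) : Finset (κ → ℕ) :=
  Fintype.piFinset fun k => Finset.range (d k + 1)

lemma degreeBox_lt {κ : Type*} [Fintype κ] [DecidableEq κ] {d : κ → ℕ}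
    (α : {a // a ∈ degreeBox d}) (k : κ) :
    α.1 k < d k + 1 :=
  Finset.mem_range.mp (Fintype.mem_piFinset.mp α.2 k)

lemma exists_sum_range_of_mem_span {V : Type*} [AddCommGroup V] [Module ℂ V] {n : ℕ}
    {A : ℕ → V} {M : V} (h : M ∈ Submodule.span ℂ (Set.range fun i : Fin n => A i)) :
    ∃ c : ℕ → ℂ, M = ∑ m ∈ Finset.range n, c m • A m := by
  obtain ⟨c, rfl⟩ := (Submodule.mem_span_range_iff_exists_fun ℂ).mp h
  refine ⟨fun m => if h : m < n then c ⟨m, h⟩ else 0, ?_⟩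
  rw [← Fin.sum_univ_eq_sum_range
    (fun m => (if h : m < n then c ⟨m, h⟩ else 0) • A m)]
  simp

lemma piKron_mem_span {κ : Type*} [Fintype κ] [DecidableEq κ] {X : κ → Type*} {d : κ → ℕ}
    {A : ∀ k, ℕ → Matrix (X k) (X k) ℂ} {M : ∀ k, Matrix (X k) (X k) ℂ}
    (h : ∀ k, M k ∈ Submodule.span ℂ (Set.range fun i : Fin (d k + 1) => A k i)) :
    piKron M ∈ Submodule.span ℂ (Set.range
      fun α : {a // a ∈ degreeBox d} =>
        piKron fun k => A k (α.1 k)) := by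
  choose c hc using fun k => exists_sum_range_of_mem_span (h k)
  rw [funext hc, piKron_sum]
  refine Submodule.sum_mem _ fun α hα => ?_
  rw [piKron_smul]
  exact Submodule.smul_mem _ _ (Submodule.subset_span ⟨⟨α, hα⟩, rfl⟩)

lemma sum_coe_piKron {κ : Type*} [Fintype κ] [DecidableEq κ] {X : κ → Type*} (d : κ → ℕ)
    (A : ∀ k, ℕ → Matrix (X k) (X k) ℂ) :
    ∑ α : {a // a ∈ degreeBox d},
        piKron (fun k => A k (α.1 k)) =
      piKron fun k => ∑ i : Fin (d k + 1), A k i := by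
  rw [Finset.sum_coe_sort _ fun α : κ → ℕ => piKron fun k => A k (α k), ← piKron_sum]
  simp only [Fin.sum_univ_eq_sum_range]

/-- The direct product of symmetric association schemes is an association scheme. -/
lemma IsAssocScheme.piKron {κ : Type*} [Fintype κ] [DecidableEq κ] {X : κ → Type*}
    [∀ k, Fintype (X k)] [∀ k, DecidableEq (X k)] {d : κ → ℕ}
    {A : ∀ k, ℕ → Matrix (X k) (X k) ℂ}
    (hscheme : ∀ k, IsAssocScheme fun i : Fin (d k + 1) => A k i)
    (hsym : ∀ k, ∀ i ≤ d k, (A k i)ᵀ = A k i) (hA0 : ∀ k, A k 0 = 1) :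
    IsAssocScheme
      fun α : {a // a ∈ degreeBox d} =>
        piKron fun k => A k (α.1 k) where
  entries_zero_one α x y := by
    by_cases h : ∃ k, A k (α.1 k) (x k) (y k) = 0
    · obtain ⟨k, hk⟩ := h
      exact Or.inl (Finset.prod_eq_zero (Finset.mem_univ k) hk)
    · push Not at h
      exact Or.inr (Finset.prod_eq_one fun k _ =>
        ((hscheme k).entries_zero_one ⟨_, degreeBox_lt α k⟩ (x k) (y k)).resolve_left (h k))
  sum_eq_J := by
    rw [sum_coe_piKron, ← piKron_matJ]
    exact congrArg _ (funext fun k => (hscheme k).sum_eq_J)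
  exists_id := ⟨⟨0, by simp⟩, by simp [hA0, piKron_one]⟩
  exists_transpose α := ⟨α, by
    rw [piKron_transpose]
    exact congrArg _ (funext fun k => hsym k _ (Nat.lt_succ_iff.mp (degreeBox_lt α k)))⟩
  mul_eq_lin α β := by
    rw [piKron_mul]
    have h := piKron_mem_span (d := d) (A := A) (M := fun k => A k (α.1 k) * A k (β.1 k))
      fun k => by
        obtain ⟨p, hp⟩ := (hscheme k).mul_eq_lin ⟨_, degreeBox_lt α k⟩
          ⟨_, degreeBox_lt β k⟩
        exact (Submodule.mem_span_range_iff_exists_fun ℂ).mpr ⟨p, hp.symm⟩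
    obtain ⟨c, hc⟩ := (Submodule.mem_span_range_iff_exists_fun ℂ).mp h
    exact ⟨c, hc.symm⟩
  mul_comm' α β := by
    rw [piKron_mul, piKron_mul]
    exact congrArg _ (funext fun k =>
      (hscheme k).mul_comm' ⟨_, degreeBox_lt α k⟩ ⟨_, degreeBox_lt β k⟩)

/-- The primitive idempotents of a direct product are the Kronecker products of the primitive
idempotents of the factors. -/
lemma IsPrimIdem.piKron {κ : Type*} [Fintype κ] [DecidableEq κ] {X : κ → Type*}
    [∀ k, Fintype (X k)] [∀ k, DecidableEq (X k)] {d : κ → ℕ}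
    {A E : ∀ k, ℕ → Matrix (X k) (X k) ℂ}
    (hprim : ∀ k, IsPrimIdem (fun i : Fin (d k + 1) => A k i)
      (fun j : Fin (d k + 1) => E k j)) :
    IsPrimIdem
      (fun α : {a // a ∈ degreeBox d} =>
        piKron fun k => A k (α.1 k))
      (fun α : {a // a ∈ degreeBox d} =>
        piKron fun k => E k (α.1 k)) where
  idem α := by
    rw [piKron_mul]
    exact congrArg _ (funext fun k => (hprim k).idem ⟨_, degreeBox_lt α k⟩)
  orth α β h := by
    obtain ⟨k, hk⟩ := Function.ne_iff.mp (Subtype.coe_ne_coe.mpr h)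
    rw [piKron_mul]
    exact piKron_eq_zero _ k ((hprim k).orth ⟨_, degreeBox_lt α k⟩
      ⟨_, degreeBox_lt β k⟩ (by simpa using hk))
  sum_eq_one := by
    rw [sum_coe_piKron, ← piKron_one]
    exact congrArg _ (funext fun k => (hprim k).sum_eq_one)
  span_eq := by
    apply le_antisymm <;> rw [Submodule.span_le] <;> rintro _ ⟨α, rfl⟩ <;>
      refine piKron_mem_span fun k => ?_
    · rw [← (hprim k).span_eq]
      exact Submodule.subset_span ⟨⟨_, degreeBox_lt α k⟩, rfl⟩
    · rw [(hprim k).span_eq]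
      exact Submodule.subset_span ⟨⟨_, degreeBox_lt α k⟩, rfl⟩

lemma hEval1_apply {X : Type*} (v : Polynomial ℂ) (M : Matrix X X ℂ) (x y : X) :
    hEval1 v M x y = v.eval (M x y) := by
  simp [hEval1, Matrix.sum_apply, Polynomial.eval_eq_sum, Polynomial.sum]

lemma MonOrder.zero_le_s13 {ℓ : ℕ} (mo : MonOrder ℓ) (a : Fin ℓ → ℕ) : mo.le 0 a := by
  by_contra h
  have ha : mo.le a 0 := (mo.le_total 0 a).resolve_left h
  have hne : a ≠ 0 := by
    rintro rfl
    exact h (mo.le_refl 0)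
  obtain ⟨_, ⟨n, rfl⟩, hmin⟩ := mo.wf.has_min (Set.range fun n : ℕ => n • a) ⟨_, 0, rfl⟩
  refine hmin _ ⟨n + 1, rfl⟩ ⟨?_, ?_⟩
  · simpa [add_smul, add_comm] using mo.add_compat _ _ (n • a) ha
  · simpa [add_smul] using hne

lemma MonOrder.le_of_le {ℓ : ℕ} (mo : MonOrder ℓ) {a b : Fin ℓ → ℕ} (h : a ≤ b) :
    mo.le a b := by
  simpa [tsub_add_cancel_of_le h] using mo.add_compat _ _ a (mo.zero_le_s13 (b - a))

/-- A product of univariate polynomials in separate variables, of degrees given by `α`, is a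
multivariate polynomial of multidegree `α`. -/
lemma exists_mvPolynomial_prod_eval {ℓ : ℕ} (mo : MonOrder ℓ) (α : Fin ℓ → ℕ)
    (v : Fin ℓ → Polynomial ℂ) (hv : ∀ k, (v k).degree = (α k : ℕ)) :
    ∃ f : MvPolynomial (Fin ℓ) ℂ,
      (∀ z : Fin ℓ → ℂ, MvPolynomial.eval z f = ∏ k, (v k).eval (z k)) ∧
      IsMultideg mo f α ∧ ∀ e ∈ f.support, ∀ k, e k ≤ α k := by
  set f : MvPolynomial (Fin ℓ) ℂ :=
    ∑ β ∈ Fintype.piFinset fun k => Finset.range (α k + 1),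
      MvPolynomial.monomial (toExp β) (∏ k, (v k).coeff (β k)) with hf
  have hcoeff (β : Fin ℓ → ℕ) : f.coeff (toExp β) =
      if β ∈ Fintype.piFinset (fun k => Finset.range (α k + 1))
        then ∏ k, (v k).coeff (β k) else 0 := by
    rw [hf, MvPolynomial.coeff_sum]
    simp [MvPolynomial.coeff_monomial, toExp]
  have hsupp : ∀ e ∈ f.support, ∀ k, e k ≤ α k := by
    intro e he
    have h := MvPolynomial.mem_support_iff.mp he
    rw [show e = toExp e from (Finsupp.equivFunOnFinite.symm_apply_apply e).symm, hcoeff] at h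
    have := (ite_ne_right_iff.mp h).1
    simpa [Nat.lt_succ_iff] using this
  refine ⟨f, fun z => ?_, ⟨?_, fun e he => mo.le_of_le (hsupp e he)⟩, hsupp⟩
  · have h (k) : (v k).eval (z k) = ∑ n ∈ Finset.range (α k + 1), (v k).coeff n * z k ^ n :=
      Polynomial.eval_eq_sum_range' (by
        rw [Polynomial.natDegree_eq_of_degree_eq_some (hv k)]
        exact Nat.lt_succ_self _) _
    simp [hf, h, Finset.prod_univ_sum, MvPolynomial.eval_monomial, Finset.prod_mul_distrib,
      Finsupp.prod_fintype, toExp]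
  · rw [hcoeff, if_pos (by simp)]
    exact Finset.prod_ne_zero_iff.mpr fun k _ => Polynomial.coeff_ne_zero_of_eq_degree (hv k)

lemma IsAssocScheme.sum_smul_apply_pow {X ι : Type*} [Fintype X] [DecidableEq X] [Fintype ι]
    {A : ι → Matrix X X ℂ} (h : IsAssocScheme A) (c : ι → ℂ) (n : ℕ) (x y : X) :
    (∑ i, c i • A i) x y ^ n = (∑ i, c i ^ n • A i) x y := by
  classical
  have hsum : ∑ i, A i x y = 1 := by
    simpa [matJ, Matrix.sum_apply] using congrFun (congrFun h.sum_eq_J x) y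
  have hval (i : ι) : A i x y = if A i x y = 1 then 1 else 0 := by
    rcases h.entries_zero_one i x y with h0 | h0 <;> simp [h0]
  have hcard : (Finset.univ.filter fun i => A i x y = 1).card = 1 := by
    have : ((Finset.univ.filter fun i => A i x y = 1).card : ℂ) = 1 := by
      rw [Finset.card_filter, Nat.cast_sum]
      refine (Finset.sum_congr rfl fun i _ => ?_).trans hsum
      rw [hval i]
      push_cast
      simp
    exact_mod_cast this
  obtain ⟨i₀, hi₀⟩ := Finset.card_eq_one.mp hcard
  have hA (i : ι) : A i x y = if i = i₀ then 1 else 0 := by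
    rw [hval]
    refine if_congr ?_ rfl rfl
    simpa using Finset.ext_iff.mp hi₀ i
  simp [Matrix.sum_apply, hA]

/-- In a `Q`-polynomial scheme of class `d` every Hadamard power of `E 1` is a combination of the
powers with exponent at most `d`. -/
lemma exists_pow_eq_sum_range {X : Type*} [Fintype X] [DecidableEq X] {d : ℕ} (hd : 1 ≤ d)
    {A E : ℕ → Matrix X X ℂ} (hscheme : IsAssocScheme fun i : Fin (d + 1) => A i)
    (hprim : IsPrimIdem (fun i : Fin (d + 1) => A i) (fun j : Fin (d + 1) => E j))
    (hQ : ∀ j ≤ d, ∃ v : Polynomial ℂ, v.degree = (j : ℕ) ∧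
      (Fintype.card X : ℂ) • E j = hEval1 v ((Fintype.card X : ℂ) • E 1)) (n : ℕ) :
    ∃ a : ℕ → ℂ, ∀ x y, E 1 x y ^ n = ∑ m ∈ Finset.range (d + 1), a m * E 1 x y ^ m := by
  have hE1 : E 1 ∈ Submodule.span ℂ (Set.range fun i : Fin (d + 1) => A i) := by
    rw [← hprim.span_eq]
    exact Submodule.subset_span ⟨⟨1, by omega⟩, rfl⟩
  obtain ⟨c, hc⟩ := (Submodule.mem_span_range_iff_exists_fun ℂ).mp hE1
  have hpow : ∑ i, c i ^ n • A (i : Fin (d + 1)) ∈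
      Submodule.span ℂ (Set.range fun j : Fin (d + 1) => E j) := by
    rw [hprim.span_eq]
    exact (Submodule.mem_span_range_iff_exists_fun ℂ).mpr ⟨_, rfl⟩
  obtain ⟨b, hb⟩ := (Submodule.mem_span_range_iff_exists_fun ℂ).mp hpow
  choose v hdeg hv using fun j : Fin (d + 1) => hQ j (Nat.lt_succ_iff.mp j.2)
  refine ⟨fun m => ∑ j, b j * ((Fintype.card X : ℂ)⁻¹ *
    ((v j).coeff m * (Fintype.card X : ℂ) ^ m)), fun x y => ?_⟩
  have hN : (Fintype.card X : ℂ) ≠ 0 := by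
    have : Nonempty X := ⟨x⟩
    exact_mod_cast Fintype.card_ne_zero
  have hEj (j : Fin (d + 1)) : E j x y = ∑ m ∈ Finset.range (d + 1),
      (Fintype.card X : ℂ)⁻¹ * ((v j).coeff m * (Fintype.card X : ℂ) ^ m) * E 1 x y ^ m := by
    have h := congrFun (congrFun (hv j) x) y
    rw [hEval1_apply, Polynomial.eval_eq_sum_range' (n := d + 1) (by
      rw [Polynomial.natDegree_eq_of_degree_eq_some (hdeg j)]
      exact j.2)] at h
    rw [← inv_mul_cancel_left₀ hN (E j x y)]
    simp only [Matrix.smul_apply, smul_eq_mul] at h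
    rw [h, Finset.mul_sum]
    exact Finset.sum_congr rfl fun m _ => by ring
  calc E 1 x y ^ n = (∑ i, c i • A (i : Fin (d + 1))) x y ^ n := by rw [hc]
    _ = (∑ j, b j • E (j : Fin (d + 1))) x y := by rw [hscheme.sum_smul_apply_pow, hb]
    _ = _ := by
      simp only [Matrix.sum_apply, Matrix.smul_apply, smul_eq_mul, hEj, Finset.mul_sum,
        Finset.sum_mul]
      rw [Finset.sum_comm]
      exact Finset.sum_congr rfl fun m _ => Finset.sum_congr rfl fun j _ => by ring

lemma piKron_epsV {ℓ : ℕ} {X : Fin ℓ → Type*} [∀ k, Fintype (X k)]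
    {E : ∀ k, ℕ → Matrix (X k) (X k) ℂ}
    (hE0 : ∀ k, E k 0 = (Fintype.card (X k) : ℂ)⁻¹ • matJ (X k)) (i : Fin ℓ) (x y : ∀ k, X k) :
    piKron (fun k => E k (epsV i k)) x y =
      (∏ k ∈ Finset.univ.erase i, (Fintype.card (X k) : ℂ)⁻¹) * E i 1 (x i) (y i) := by
  simp only [piKron, Matrix.of_apply]
  rw [← Finset.prod_erase_mul _ _ (Finset.mem_univ i)]
  congr 1
  · refine Finset.prod_congr rfl fun k hk => ?_
    simp [epsV, Pi.single_eq_of_ne (Finset.ne_of_mem_erase hk), hE0, matJ]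
  · simp [epsV]

lemma card_smul_piKron_epsV {ℓ : ℕ} {X : Fin ℓ → Type*} [∀ k, Fintype (X k)]
    {E : ∀ k, ℕ → Matrix (X k) (X k) ℂ}
    (hE0 : ∀ k, E k 0 = (Fintype.card (X k) : ℂ)⁻¹ • matJ (X k)) (i : Fin ℓ) (x y : ∀ k, X k) :
    ((Fintype.card (∀ k, X k) : ℂ) • piKron (fun k => E k (epsV i k))) x y =
      (Fintype.card (X i) : ℂ) * E i 1 (x i) (y i) := by
  have hN (k) : (Fintype.card (X k) : ℂ) ≠ 0 := by
    have : Nonempty (X k) := ⟨x k⟩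
    exact_mod_cast Fintype.card_ne_zero
  rw [Matrix.smul_apply, piKron_epsV hE0, Fintype.card_pi, Nat.cast_prod,
    ← Finset.prod_erase_mul _ _ (Finset.mem_univ i), smul_eq_mul, Finset.prod_inv_distrib]
  have := Finset.prod_ne_zero_iff.mpr fun k (_ : k ∈ Finset.univ.erase i) => hN k
  field_simp

/-- Multiplying a Hadamard monomial by `G i`, where the powers of `G i` up to exponent `d i + 1`
reduce to those up to exponent `d i`. -/
lemma exists_hadamard_hpow_eq_sum {X : Type*} {ℓ : ℕ} (mo : MonOrder ℓ) {d : Fin ℓ → ℕ}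
    (G : Fin ℓ → Matrix X X ℂ) (i : Fin ℓ) {α : Fin ℓ → ℕ}
    (hα : α ∈ degreeBox d)
    (a : ℕ → ℂ) (ha : ∀ m, a m ≠ 0 → m ≤ α i + 1)
    (hG : ∀ x y, G i x y ^ (α i + 1) = ∑ m ∈ Finset.range (d i + 1), a m * G i x y ^ m) :
    ∃ c : (Fin ℓ → ℕ) → ℂ,
      (Matrix.hadamard (G i) (hpow G α) =
        ∑ β ∈ degreeBox d, c β • hpow G β) ∧
      ∀ β ∈ degreeBox d,
        c β ≠ 0 → mo.le β (α + epsV i) := by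
  refine ⟨fun β => ∑ m ∈ Finset.range (d i + 1),
    if β = Function.update α i m then a m else 0, ?_, fun β _ hβ => ?_⟩
  · have hmem (m) (hm : m ∈ Finset.range (d i + 1)) :
        Function.update α i m ∈ degreeBox d := by
      refine Fintype.mem_piFinset.mpr fun k => ?_
      rcases eq_or_ne k i with rfl | hk
      · simpa using hm
      · simpa [hk] using Fintype.mem_piFinset.mp hα k
    have hupd (m : ℕ) (x y : X) : hpow G (Function.update α i m) x y =
        (∏ k ∈ Finset.univ.erase i, G k x y ^ α k) * G i x y ^ m := by
      simp only [hpow, Matrix.of_apply]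
      rw [← Finset.prod_erase_mul _ _ (Finset.mem_univ i), Function.update_self]
      congr 1
      exact Finset.prod_congr rfl fun k hk => by
        rw [Function.update_of_ne (Finset.ne_of_mem_erase hk)]
    have hrhs : ∑ β ∈ degreeBox d,
        (∑ m ∈ Finset.range (d i + 1), if β = Function.update α i m then a m else 0) • hpow G β =
        ∑ m ∈ Finset.range (d i + 1), a m • hpow G (Function.update α i m) := by
      simp only [Finset.sum_smul]
      rw [Finset.sum_comm]
      refine Finset.sum_congr rfl fun m hm => ?_
      simp only [ite_smul, zero_smul]
      rw [Finset.sum_ite_eq', if_pos (hmem m hm)]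
    rw [hrhs]
    ext x y
    have hself := hupd (α i) x y
    rw [Function.update_eq_self] at hself
    simp only [Matrix.hadamard_apply, hself, Matrix.sum_apply, Matrix.smul_apply, smul_eq_mul,
      hupd]
    rw [mul_left_comm, ← pow_succ', hG, Finset.mul_sum]
    exact Finset.sum_congr rfl fun m _ => by ring
  · obtain ⟨m, -, hne⟩ := Finset.exists_ne_zero_of_sum_ne_zero hβ
    obtain ⟨rfl, hm⟩ := ite_ne_right_iff.mp hne
    refine mo.le_of_le fun k => ?_
    rcases eq_or_ne k i with rfl | hk
    · simpa [epsV] using ha m hm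
    · simp [epsV, hk]


/-- Theorem 4.1 (ii): the direct product of `Q`-polynomial association schemes
`𝔛^{(1)}, …, 𝔛^{(ℓ)}`, whose primitive idempotents are the Kronecker products
`E^{(1)}_{n 1} ⊗ ⋯ ⊗ E^{(ℓ)}_{n ℓ}`, is an `ℓ`-variate `Q`-polynomial association scheme on
`D = {0,…,d 1} × ⋯ × {0,…,d ℓ}` with respect to every monomial order. -/
theorem directProduct_isMultiQPoly {ℓ : ℕ} (X : Fin ℓ → Type*)
    [∀ k, Fintype (X k)] [∀ k, DecidableEq (X k)]
    (d : Fin ℓ → ℕ) (hd : ∀ k, 1 ≤ d k)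
    (A : ∀ k, ℕ → Matrix (X k) (X k) ℂ) (E : ∀ k, ℕ → Matrix (X k) (X k) ℂ)
    (hscheme : ∀ k, IsAssocScheme fun i : Fin (d k + 1) => A k i)
    (hsym : ∀ k, ∀ i ≤ d k, (A k i)ᵀ = A k i)
    (hA0 : ∀ k, A k 0 = 1)
    (hprim : ∀ k, IsPrimIdem (fun i : Fin (d k + 1) => A k i) (fun j : Fin (d k + 1) => E k j))
    (hE0 : ∀ k, E k 0 = (Fintype.card (X k) : ℂ)⁻¹ • matJ (X k))
    (hQ : ∀ k, ∀ j ≤ d k, ∃ v : Polynomial ℂ, v.degree = (j : ℕ) ∧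
      (Fintype.card (X k) : ℂ) • E k j = hEval1 v ((Fintype.card (X k) : ℂ) • E k 1))
    (mo : MonOrder ℓ) :
    IsMultiQPoly (Fintype.piFinset fun k => Finset.range (d k + 1)) mo
      (fun α : {a // a ∈ (Fintype.piFinset fun k => Finset.range (d k + 1))} =>
        Matrix.of fun x y : ∀ k, X k => ∏ k, A k (α.1 k) (x k) (y k))
      (fun α => Matrix.of fun x y : ∀ k, X k => ∏ k, E k (α k) (x k) (y k)) := by
  change IsMultiQPoly _ mo
    (fun α : {a // a ∈ degreeBox d} =>
      piKron fun k => A k (α.1 k)) (fun α => piKron fun k => E k (α k))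
  refine ⟨IsAssocScheme.piKron hscheme hsym hA0, IsPrimIdem.piKron hprim, fun i => ?_,
    fun α hα β h => ?_, fun α hα => ?_, fun i α hα => ?_⟩
  · refine Fintype.mem_piFinset.mpr fun k => Finset.mem_range.mpr ?_
    rcases eq_or_ne k i with rfl | hk
    · simpa [epsV] using Nat.succ_le_iff.mp (hd k)
    · simp [epsV, hk]
  · exact Fintype.mem_piFinset.mpr fun k => Finset.mem_range.mpr
      ((h k).trans_lt (Finset.mem_range.mp (Fintype.mem_piFinset.mp hα k)))
  · have hle (k) : α k ≤ d k :=
      Nat.lt_succ_iff.mp (Finset.mem_range.mp (Fintype.mem_piFinset.mp hα k))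
    choose v hdeg hv using fun k => hQ k (α k) (hle k)
    obtain ⟨f, hf, hmulti, hsupp⟩ := exists_mvPolynomial_prod_eval mo α v hdeg
    refine ⟨f, ?_, hmulti, fun e he => Fintype.mem_piFinset.mpr fun k =>
      Finset.mem_range.mpr (Nat.lt_succ_iff.mpr ((hsupp e he k).trans (hle k)))⟩
    ext x y
    rw [hEval_apply, hf]
    simp only [card_smul_piKron_epsV hE0]
    rw [Fintype.card_pi, Nat.cast_prod, ← piKron_smul]
    simp only [piKron, Matrix.of_apply]
    refine Finset.prod_congr rfl fun k _ => ?_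
    rw [hv k, hEval1_apply]
    rfl
  · have hle : α i ≤ d i :=
      Nat.lt_succ_iff.mp (Finset.mem_range.mp (Fintype.mem_piFinset.mp hα i))
    rcases hle.lt_or_eq with hlt | heq
    · refine exists_hadamard_hpow_eq_sum mo (fun j => piKron fun k => E k (epsV j k)) i hα
        (fun m => if m = α i + 1 then 1 else 0) (fun m hm => ?_) fun x y => ?_
      · exact (ite_ne_right_iff.mp hm).1.le
      · simp [hlt]
    · obtain ⟨a, ha⟩ := exists_pow_eq_sum_range (hd i) (hscheme i) (hprim i) (hQ i) (α i + 1)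
      set s : ℂ := ∏ k ∈ Finset.univ.erase i, (Fintype.card (X k) : ℂ)⁻¹ with hs
      refine exists_hadamard_hpow_eq_sum mo (fun j => piKron fun k => E k (epsV j k)) i hα
        (fun m => if m ≤ α i + 1 then a m * s ^ (α i + 1 - m) else 0) (fun m hm => ?_)
        fun x y => ?_
      · exact (ite_ne_right_iff.mp hm).1
      · simp only [piKron_epsV hE0, ← hs]
        rw [mul_pow, ha, Finset.mul_sum]
        refine Finset.sum_congr rfl fun m hm => ?_
        have hm' : m ≤ α i + 1 := by
          have := Finset.mem_range.mp hm
          omega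
        rw [if_pos hm', ← Nat.sub_add_cancel hm', pow_add, Nat.add_sub_cancel, mul_pow]
        ring
end

section
/- Let 𝔛 be the group association scheme of the additive group 𝔽₂³, i.e., the commutative association scheme on X = 𝔽₂³ with adjacency matrices {A_g}_{g∈𝔽₂³} where (A_g)_{x,y} = 1 if y − x = g and 0 otherwise (this scheme equals the threefold direct product K₂ ⊗ K₂ ⊗ K₂). Then for any two adjacency matrices A_g, A_h, the dimension of the ℂ-span of {A_g^m A_h^n : m, n ∈ ℕ} is at most 4; consequently, 𝔛 (which has 8 classes counted with identity) is not a bivariate P-polynomial association scheme on any domain D ⊆ ℕ² with respect to any monomial order. -/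
open scoped BigOperators
open Matrix

/-- The adjacency matrices of the group association scheme of `(𝔽₂³, +)`
(equivalently, of `K₂ ⊗ K₂ ⊗ K₂`). -/
def grpA (g : Fin 3 → ZMod 2) :
    Matrix (Fin 3 → ZMod 2) (Fin 3 → ZMod 2) ℂ :=
  Matrix.of fun x y => if y - x = g then 1 else 0

theorem grpA_zero : grpA 0 = 1 := by
  ext x y
  simp [grpA, Matrix.one_apply, sub_eq_zero, eq_comm]

theorem grpA_mul (g h : Fin 3 → ZMod 2) : grpA g * grpA h = grpA (g + h) := by
  ext x y
  simp only [grpA, Matrix.mul_apply, Matrix.of_apply]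
  rw [Finset.sum_eq_single (x + g)]
  · simp [← sub_sub, sub_eq_iff_eq_add']
  · intro z _ hz
    rw [if_neg (fun h' => hz (sub_eq_iff_eq_add'.mp h')), zero_mul]
  · simp

theorem grpA_pow (g : Fin 3 → ZMod 2) (n : ℕ) : grpA g ^ n = grpA (n • g) := by
  induction n with
  | zero => simp [grpA_zero]
  | succ n ih => rw [pow_succ, ih, grpA_mul, succ_nsmul]

theorem linearIndependent_grpA : LinearIndependent ℂ grpA := by
  rw [Fintype.linearIndependent_iff]
  intro c hc g
  have := congrFun (congrFun hc 0) g
  simpa [Matrix.sum_apply, grpA] using this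

theorem finrank_span_grpA_pow_mul_pow_le (g h : Fin 3 → ZMod 2) :
    Module.finrank ℂ
      ↥(Submodule.span ℂ
        {M : Matrix (Fin 3 → ZMod 2) (Fin 3 → ZMod 2) ℂ |
          ∃ m n : ℕ, M = grpA g ^ m * grpA h ^ n}) ≤ 4 := by
  let b : ZMod 2 × ZMod 2 → Matrix (Fin 3 → ZMod 2) (Fin 3 → ZMod 2) ℂ :=
    fun p => grpA (p.1 • g + p.2 • h)
  have hsub : {M : Matrix (Fin 3 → ZMod 2) (Fin 3 → ZMod 2) ℂ |
      ∃ m n : ℕ, M = grpA g ^ m * grpA h ^ n} ⊆ Set.range b := by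
    rintro _ ⟨m, n, rfl⟩
    exact ⟨(m, n), by simp only [b, grpA_pow, grpA_mul, Nat.cast_smul_eq_nsmul]⟩
  calc _ ≤ (Set.range b).finrank ℂ := Submodule.finrank_mono (Submodule.span_mono hsub)
    _ ≤ Fintype.card (ZMod 2 × ZMod 2) := finrank_range_le_card b
    _ = 4 := by simp

theorem matEval_mem_span {X : Type*} [Fintype X] [DecidableEq X]
    (v : MvPolynomial (Fin 2) ℂ) (M : Fin 2 → Matrix X X ℂ) :
    matEval v M ∈ Submodule.span ℂ {N | ∃ m n : ℕ, N = M 0 ^ m * M 1 ^ n} :=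
  Submodule.sum_mem _ fun d _ => Submodule.smul_mem _ _ <| Submodule.subset_span
    ⟨d 0, d 1, by simp [mpow, List.finRange_succ]⟩

/-- Section 4.1: for the group association scheme of `𝔽₂³` (that is, `K₂ ⊗ K₂ ⊗ K₂`), the span
of `{A_g^m A_h^n}` has dimension at most `4` for any two adjacency matrices `A_g, A_h`;
consequently this 8-class scheme is not a bivariate `P`-polynomial association scheme for any
domain, relabeling, and monomial order. -/
theorem F2cube_not_bivariatePPoly :
    (∀ g h : Fin 3 → ZMod 2,
      Module.finrank ℂ
        ↥(Submodule.span ℂ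
          {M : Matrix (Fin 3 → ZMod 2) (Fin 3 → ZMod 2) ℂ |
            ∃ m n : ℕ, M = grpA g ^ m * grpA h ^ n}) ≤ 4) ∧
      ¬ ∃ (D : Finset (Fin 2 → ℕ)) (mo : MonOrder 2)
          (B : (Fin 2 → ℕ) → Matrix (Fin 3 → ZMod 2) (Fin 3 → ZMod 2) ℂ)
          (e : {a // a ∈ D} ≃ (Fin 3 → ZMod 2)),
          (∀ α : {a // a ∈ D}, B α.1 = grpA (e α)) ∧ IsMultiPPoly D mo B := by
  refine ⟨finrank_span_grpA_pow_mul_pow_le, ?_⟩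
  rintro ⟨D, mo, B, e, hB, hP⟩
  have hspan : Submodule.span ℂ (Set.range grpA) ≤
      Submodule.span ℂ {N | ∃ m n : ℕ, N = B (epsV 0) ^ m * B (epsV 1) ^ n} := by
    rw [Submodule.span_le]
    rintro _ ⟨x, rfl⟩
    obtain ⟨α, rfl⟩ := e.surjective x
    obtain ⟨v, hv, -⟩ := hP.exists_poly α.1 α.2
    rw [← hB α, hv]
    exact matEval_mem_span v fun i => B (epsV i)
  have hle := Submodule.finrank_mono hspan
  rw [finrank_span_eq_card linearIndependent_grpA, hB ⟨_, hP.eps_mem 0⟩,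
    hB ⟨_, hP.eps_mem 1⟩] at hle
  have hcard : Fintype.card (Fin 3 → ZMod 2) = 8 := by simp [ZMod.card]
  have := hle.trans (finrank_span_grpA_pow_mul_pow_le _ _)
  omega
end
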